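/- arXiv:math/0612174 — 4 statements merged into one kernel-verified Lean document; each statement's English description precedes it below -/
import Mathlib

section
/- Let g = sl₂(ℂ) with standard basis e, f, h, let g̃ = ℂ[t,t⁻¹] ⊗ g be its loop algebra, and write x_r for the action of t^r ⊗ x on a g̃-module. Let V be a finite-dimensional g̃-module and v ∈ V a nonzero vector such that e_r·v = 0 for all r ∈ ℤ and h_s·v = ω_s·v for all s ∈ ℤ, where ω_s ∈ ℂ. Then ω₀ is a nonnegative integer λ, and there exist nonzero complex numbers a_1, …, a_λ such that ω_s = a_1^s + a_2^s + ⋯ + a_λ^s for every s ∈ ℤ (both positive and negative). -/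
set_option synthInstance.maxHeartbeats 1000000
set_option maxHeartbeats 1000000

open scoped TensorProduct
open LaurentPolynomial LieAlgebra.SpecialLinear

/-- `e` in the standard basis of `sl₂`. -/
noncomputable def Esl2 : sl (Fin 2) ℂ :=
  ⟨!![0,1;0,0], show _ ∈ LinearMap.ker (Matrix.traceLinearMap (Fin 2) ℂ ℂ) by
    simp [LinearMap.mem_ker, Matrix.trace_fin_two]⟩

/-- `f` in the standard basis of `sl₂`. -/
noncomputable def Fsl2 : sl (Fin 2) ℂ :=
  ⟨!![0,0;1,0], show _ ∈ LinearMap.ker (Matrix.traceLinearMap (Fin 2) ℂ ℂ) by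
    simp [LinearMap.mem_ker, Matrix.trace_fin_two]⟩

/-- `h` in the standard basis of `sl₂`. -/
noncomputable def Hsl2 : sl (Fin 2) ℂ :=
  ⟨!![1,0;0,-1], show _ ∈ LinearMap.ker (Matrix.traceLinearMap (Fin 2) ℂ ℂ) by
    simp [LinearMap.mem_ker, Matrix.trace_fin_two]⟩

/-- The loop algebra `g̃ = ℂ[t,t⁻¹] ⊗ sl₂(ℂ)`. -/
abbrev loopSl2 := ℂ[T;T⁻¹] ⊗[ℂ] (sl (Fin 2) ℂ)

/-- The loop algebra is a Lie algebra over `ℂ`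
(by restriction of scalars from `ℂ[t,t⁻¹]`). -/
noncomputable instance : LieAlgebra ℂ loopSl2 where
  lie_smul t x y := by
    rw [← algebraMap_smul ℂ[T;T⁻¹] t y,
      lie_smul (algebraMap ℂ ℂ[T;T⁻¹] t) x y, algebraMap_smul]

section CurrentAlgebra

attribute [local instance] LieRing.ofAssociativeRing

/-- Operators `E p`, `H p`, `F p` on `V`, linear in `p ∈ R`, satisfying the relations of the
current algebra `R ⊗ sl₂`. -/
structure IsCurrentSl2Rep {R V : Type*} [CommRing R] [Algebra ℂ R] [AddCommGroup V] [Module ℂ V]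
    (E H F : R →ₗ[ℂ] Module.End ℂ V) : Prop where
  lie_E_F : ∀ p q, ⁅E p, F q⁆ = H (p * q)
  lie_H_E : ∀ p q, ⁅H p, E q⁆ = (2 : ℂ) • E (p * q)
  lie_H_F : ∀ p q, ⁅H p, F q⁆ = (-2 : ℂ) • F (p * q)

namespace IsCurrentSl2Rep

variable {R V : Type*} [CommRing R] [Algebra ℂ R] [AddCommGroup V] [Module ℂ V]
  {E H F : R →ₗ[ℂ] Module.End ℂ V}

/-- The elements `p` for which `F p` acts by zero form an ideal. -/
def kernel (h : IsCurrentSl2Rep E H F) : Ideal R where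
  carrier := {p | F p = 0}
  add_mem' hp hq := by simp_all
  zero_mem' := map_zero F
  smul_mem' c p hp := by
    have := h.lie_H_F c p
    rw [show F p = 0 from hp, lie_zero] at this
    simpa using this.symm

lemma mem_kernel (h : IsCurrentSl2Rep E H F) {p : R} : p ∈ h.kernel ↔ F p = 0 := Iff.rfl

lemma H_eq_zero (h : IsCurrentSl2Rep E H F) {p : R} (hp : p ∈ h.kernel) : H p = 0 := by
  have := h.lie_E_F 1 p
  rw [h.mem_kernel.1 hp, lie_zero, one_mul] at this
  exact this.symm

lemma E_eq_zero (h : IsCurrentSl2Rep E H F) {p : R} (hp : p ∈ h.kernel) : E p = 0 := by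
  have := h.lie_H_E p 1
  rw [h.H_eq_zero hp, zero_lie, mul_one] at this
  simpa using this.symm

lemma ad_H_pow_E (h : IsCurrentSl2Rep E H F) (p q : R) (n : ℕ) :
    ((LieAlgebra.ad ℂ (Module.End ℂ V) (H p)) ^ n) (E q) = (2 : ℂ) ^ n • E (p ^ n * q) := by
  induction n with
  | zero => simp
  | succ n ih =>
    rw [pow_succ', Module.End.mul_apply, ih, map_smul, LieAlgebra.ad_apply, h.lie_H_E, smul_smul,
      ← pow_succ, ← mul_assoc, ← pow_succ']

lemma ad_H_pow_F (h : IsCurrentSl2Rep E H F) (p q : R) (n : ℕ) :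
    ((LieAlgebra.ad ℂ (Module.End ℂ V) (H p)) ^ n) (F q) = (-2 : ℂ) ^ n • F (p ^ n * q) := by
  induction n with
  | zero => simp
  | succ n ih =>
    rw [pow_succ', Module.End.mul_apply, ih, map_smul, LieAlgebra.ad_apply, h.lie_H_F, smul_smul,
      ← pow_succ, ← mul_assoc, ← pow_succ']

/-- An endomorphism killed by a power of `ad x` preserves the generalized eigenspaces of `x`. -/
lemma _root_.Module.End.mapsTo_maxGenEigenspace_of_ad_pow_eq_zero {x y : Module.End ℂ V} {n : ℕ}
    (hn : ((LieAlgebra.ad ℂ (Module.End ℂ V) x) ^ n) y = 0) (c : ℂ) :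
    Set.MapsTo y (x.maxGenEigenspace c) (x.maxGenEigenspace c) := by
  intro m hm
  have hy : y ∈ (LieModule.toEnd ℂ (Module.End ℂ V) (Module.End ℂ V) x).maxGenEigenspace 0 := by
    rw [Module.End.mem_maxGenEigenspace]
    exact ⟨n, by rw [zero_smul, sub_zero]; exact hn⟩
  have := LieModule.lie_mem_maxGenEigenspace_toEnd (M := V) (m := m) (χ₂ := c) hy
    (by simpa using hm)
  simpa using this

/-- If `⁅y, z⁆ = x` and both `y` and `z` are killed by powers of `ad x`, then `x` has no nonzero
eigenvalue. -/
lemma _root_.Module.End.eigenvalue_eq_zero_of_lie_eq [FiniteDimensional ℂ V]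
    {x y z : Module.End ℂ V} (hyz : ⁅y, z⁆ = x) {n : ℕ}
    (hy : ((LieAlgebra.ad ℂ (Module.End ℂ V) x) ^ n) y = 0)
    (hz : ((LieAlgebra.ad ℂ (Module.End ℂ V) x) ^ n) z = 0)
    {v : V} (hv : v ≠ 0) {c : ℂ} (hx : x v = c • v) : c = 0 := by
  set W := x.maxGenEigenspace c
  have hyW : Set.MapsTo y W W := Module.End.mapsTo_maxGenEigenspace_of_ad_pow_eq_zero hy c
  have hzW : Set.MapsTo z W W := Module.End.mapsTo_maxGenEigenspace_of_ad_pow_eq_zero hz c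
  have hvW : v ∈ W := by
    rw [Module.End.mem_maxGenEigenspace]
    exact ⟨1, by simp [hx]⟩
  have : Nontrivial W := ⟨⟨v, hvW⟩, 0, by simpa [Subtype.ext_iff] using hv⟩
  have hnil := LinearMap.isNilpotent_trace_of_isNilpotent
    (Module.End.isNilpotent_restrict_maxGenEigenspace_sub_algebraMap x c)
  have key : LinearMap.restrict (x - algebraMap ℂ (Module.End ℂ V) c)
      (Module.End.mapsTo_maxGenEigenspace_of_comm (Algebra.mul_sub_algebraMap_commutes x c) c) =
      y.restrict hyW * z.restrict hzW - z.restrict hzW * y.restrict hyW - c • 1 := by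
    ext w
    simp [← hyz, Ring.lie_def]
    rfl
  have htr := hnil.eq_zero
  rw [key, map_sub, map_sub, LinearMap.trace_mul_comm, sub_self, map_smul,
    LinearMap.trace_one] at htr
  simpa [Module.finrank_pos.ne'] using htr

variable [FiniteDimensional ℂ V]

lemma eigenvalue_eq_zero (h : IsCurrentSl2Rep E H F) {v : V} (hv : v ≠ 0) {p : R} {n : ℕ}
    (hp : p ^ n ∈ h.kernel) {c : ℂ} (hc : H p v = c • v) : c = 0 := by
  have hpq (q : R) : p ^ n * q ∈ h.kernel := h.kernel.mul_mem_right q hp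
  refine Module.End.eigenvalue_eq_zero_of_lie_eq (y := E 1) (z := F p) (n := n) ?_ ?_ ?_ hv hc
  · rw [h.lie_E_F, one_mul]
  · rw [h.ad_H_pow_E, h.E_eq_zero (hpq 1), smul_zero]
  · rw [h.ad_H_pow_F, h.mem_kernel.1 (hpq p), smul_zero]

lemma exists_eigenvalue_eq_natCast (h : IsCurrentSl2Rep E H F) {v : V} (hv : v ≠ 0)
    {p : R} (hp : p * p - p ∈ h.kernel) (he : E p v = 0) {c : ℂ} (hc : H p v = c • v) :
    ∃ n : ℕ, c = n := by
  by_cases h0 : H p = 0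
  · exact ⟨0, by simpa [h0, hv, eq_comm] using hc⟩
  have hH : H (p * p) = H p := sub_eq_zero.1 (by rw [← map_sub, h.H_eq_zero hp])
  have hE : E (p * p) = E p := sub_eq_zero.1 (by rw [← map_sub, h.E_eq_zero hp])
  have hF : F (p * p) = F p := sub_eq_zero.1 (by rw [← map_sub, h.mem_kernel.1 hp])
  have t : IsSl2Triple (H p) (E p) (F p) :=
    { h_ne_zero := h0
      lie_e_f := by rw [h.lie_E_F, hH]
      lie_h_e_nsmul := by rw [h.lie_H_E, hE, two_smul, two_nsmul]
      lie_h_f_nsmul := by rw [h.lie_H_F, hF, neg_smul, two_smul, two_nsmul] }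
  have P : t.HasPrimitiveVectorWith v c := ⟨hv, hc, he⟩
  exact P.exists_nat

lemma finite_quotient_kernel (h : IsCurrentSl2Rep E H F) :
    FiniteDimensional ℂ (R ⧸ h.kernel) := by
  have : h.kernel.restrictScalars ℂ = LinearMap.ker F := by
    ext; exact h.mem_kernel
  have e : (R ⧸ LinearMap.ker F) ≃ₗ[ℂ] LinearMap.range F := F.quotKerEquivRange
  have : FiniteDimensional ℂ (R ⧸ h.kernel.restrictScalars ℂ) := by
    rw [this]
    exact Module.Finite.equiv e.symm
  exact Module.Finite.equiv (Submodule.Quotient.restrictScalarsEquiv ℂ h.kernel)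

end IsCurrentSl2Rep

/-- A linear functional on a finite-dimensional commutative `ℂ`-algebra which kills nilpotents and
takes natural number values on idempotents is a finite sum of characters. -/
lemma exists_eq_sum_algHom {A : Type*} [CommRing A] [Algebra ℂ A] [FiniteDimensional ℂ A]
    (ψ : A →ₗ[ℂ] ℂ) (hnil : ∀ x, IsNilpotent x → ψ x = 0)
    (hidem : ∀ x, IsIdempotentElem x → ∃ n : ℕ, ψ x = n) :
    ∃ (k : ℕ) (φ : Fin k → A →ₐ[ℂ] ℂ), ∀ x, ψ x = ∑ j, φ j x := by
  classical
  have : IsArtinianRing A := IsArtinianRing.of_finite ℂ A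
  have : Fintype (MaximalSpectrum A) := Fintype.ofFinite _
  let Φ := IsArtinianRing.quotNilradicalEquivPi A
  let π : A →+* ∀ I : MaximalSpectrum A, A ⧸ I.asIdeal :=
    (Φ : _ →+* _).comp (Ideal.Quotient.mk (nilradical A))
  have hπ (x : A) (I : MaximalSpectrum A) : π x I = Ideal.Quotient.mk I.asIdeal x := by
    change Φ (algebraMap A _ x) I = _
    rw [AlgEquiv.commutes]; rfl
  have hker : ∀ x ∈ RingHom.ker π, IsNilpotent x := by
    intro x hx
    rw [RingHom.mem_ker] at hx
    have : Φ (Ideal.Quotient.mk (nilradical A) x) = 0 := hx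
    rw [EmbeddingLike.map_eq_zero_iff, Ideal.Quotient.eq_zero_iff_mem] at this
    exact this
  have hsurj : Function.Surjective π := Φ.surjective.comp Ideal.Quotient.mk_surjective
  have hex (I : MaximalSpectrum A) : ∃ e, IsIdempotentElem e ∧ π e = Pi.single I 1 :=
    exists_isIdempotentElem_eq_of_ker_isNilpotent π hker _ (hsurj _)
      (by rw [IsIdempotentElem, ← Pi.single_mul, one_mul])
  choose e he hπe using hex
  choose n hn using fun I => hidem (e I) (he I)
  have hbij (I : MaximalSpectrum A) : Function.Bijective (algebraMap ℂ (A ⧸ I.asIdeal)) := by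
    have := I.isMaximal
    exact IsAlgClosed.algebraMap_bijective_of_isIntegral
  let χ (I : MaximalSpectrum A) : A →ₐ[ℂ] ℂ :=
    ((AlgEquiv.ofBijective (Algebra.ofId ℂ (A ⧸ I.asIdeal)) (hbij I)).symm : _ →ₐ[ℂ] ℂ).comp
      (Ideal.Quotient.mkₐ ℂ I.asIdeal)
  have hχ (I : MaximalSpectrum A) (x : A) :
      algebraMap ℂ (A ⧸ I.asIdeal) (χ I x) = Ideal.Quotient.mk I.asIdeal x :=
    (AlgEquiv.ofBijective (Algebra.ofId ℂ (A ⧸ I.asIdeal)) (hbij I)).apply_symm_apply _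
  have key (x : A) : ψ x = ∑ I, n I * χ I x := by
    have hx : IsNilpotent (x - ∑ I, χ I x • e I) := by
      apply hker
      rw [RingHom.mem_ker, map_sub, sub_eq_zero, map_sum]
      ext J
      rw [Finset.sum_apply, Finset.sum_eq_single J]
      · rw [Algebra.smul_def, map_mul, Pi.mul_apply, hπe, Pi.single_eq_same, mul_one, hπ, hπ,
          ← hχ]
        rfl
      · intro I _ hI
        rw [Algebra.smul_def, map_mul, Pi.mul_apply, hπe, Pi.single_eq_of_ne hI.symm, mul_zero]
      · simp
    have := hnil _ hx
    rw [map_sub, sub_eq_zero, map_sum] at this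
    rw [this]
    exact Finset.sum_congr rfl fun I _ => by rw [map_smul, hn, smul_eq_mul, mul_comm]
  let S := Σ I : MaximalSpectrum A, Fin (n I)
  refine ⟨Fintype.card S, fun j => χ ((Fintype.equivFin S).symm j).1, fun x => ?_⟩
  rw [key, (Fintype.equivFin S).symm.sum_comp (fun s : S => χ s.1 x), Fintype.sum_sigma]
  simp

lemma IsCurrentSl2Rep.exists_eq_sum_algHom {R V : Type*} [CommRing R] [Algebra ℂ R]
    [AddCommGroup V] [Module ℂ V] [FiniteDimensional ℂ V] {E H F : R →ₗ[ℂ] Module.End ℂ V}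
    (h : IsCurrentSl2Rep E H F) {v : V} (hv : v ≠ 0) (hE : ∀ p, E p v = 0) (ψ : R →ₗ[ℂ] ℂ)
    (hH : ∀ p, H p v = ψ p • v) :
    ∃ (k : ℕ) (φ : Fin k → R →ₐ[ℂ] ℂ), ∀ p, ψ p = ∑ j, φ j p := by
  have := h.finite_quotient_kernel
  have hψ : ∀ p ∈ h.kernel.restrictScalars ℂ, ψ p = 0 := fun p hp => by
    simpa [h.H_eq_zero hp, hv] using (hH p).symm
  let ψ' : (R ⧸ h.kernel) →ₗ[ℂ] ℂ := (Submodule.liftQ _ ψ hψ).comp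
    (Submodule.Quotient.restrictScalarsEquiv ℂ h.kernel).symm.toLinearMap
  have hψ' (p : R) : ψ' (Ideal.Quotient.mk _ p) = ψ p := rfl
  obtain ⟨k, φ, hφ⟩ := _root_.exists_eq_sum_algHom ψ'
    (fun x ⟨n, hn⟩ => by
      obtain ⟨p, rfl⟩ := Ideal.Quotient.mk_surjective x
      rw [← map_pow, Ideal.Quotient.eq_zero_iff_mem] at hn
      exact h.eigenvalue_eq_zero hv hn (hH p))
    (fun x hx => by
      obtain ⟨p, rfl⟩ := Ideal.Quotient.mk_surjective x
      rw [IsIdempotentElem, ← map_mul, Ideal.Quotient.eq] at hx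
      exact h.exists_eigenvalue_eq_natCast hv hx (hE p) (hH p))
  exact ⟨k, fun j => (φ j).comp (Ideal.Quotient.mkₐ ℂ h.kernel), fun p => (hψ' p).symm.trans (hφ _)⟩

/-- The action of `p ⊗ x` on a module over the loop algebra, linear in `p`. -/
noncomputable def loopSl2Action (V : Type*) [AddCommGroup V] [Module ℂ V]
    [LieRingModule loopSl2 V] [LieModule ℂ loopSl2 V] (x : sl (Fin 2) ℂ) :
    ℂ[T;T⁻¹] →ₗ[ℂ] Module.End ℂ V :=
  (LieModule.toEnd ℂ loopSl2 V : loopSl2 →ₗ[ℂ] Module.End ℂ V).comp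
    ((TensorProduct.mk ℂ ℂ[T;T⁻¹] (sl (Fin 2) ℂ)).flip x)

section Action

variable (V : Type*) [AddCommGroup V] [Module ℂ V]
  [LieRingModule loopSl2 V] [LieModule ℂ loopSl2 V]

lemma loopSl2Action_apply (x : sl (Fin 2) ℂ) (p : ℂ[T;T⁻¹]) (v : V) :
    loopSl2Action V x p v = ⁅(p ⊗ₜ[ℂ] x : loopSl2), v⁆ := rfl

lemma lie_loopSl2Action (x y : sl (Fin 2) ℂ) (p q : ℂ[T;T⁻¹]) :
    ⁅loopSl2Action V x p, loopSl2Action V y q⁆ = loopSl2Action V ⁅x, y⁆ (p * q) := by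
  ext v
  rw [loopSl2Action_apply, ← LieAlgebra.ExtendScalars.bracket_tmul,
    LieRing.of_associative_ring_bracket, lie_lie]
  rfl

lemma loopSl2Action_smul (c : ℂ) (x : sl (Fin 2) ℂ) (p : ℂ[T;T⁻¹]) :
    loopSl2Action V (c • x) p = c • loopSl2Action V x p := by
  simp [loopSl2Action]

lemma isCurrentSl2Rep_loopSl2Action :
    IsCurrentSl2Rep (loopSl2Action V Esl2) (loopSl2Action V Hsl2) (loopSl2Action V Fsl2) where
  lie_E_F p q := by
    have : ⁅Esl2, Fsl2⁆ = Hsl2 := by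
      ext i j; fin_cases i <;> fin_cases j <;> simp [Esl2, Fsl2, Hsl2, Ring.lie_def]
    rw [lie_loopSl2Action, this]
  lie_H_E p q := by
    have : ⁅Hsl2, Esl2⁆ = (2 : ℂ) • Esl2 := by
      ext i j; fin_cases i <;> fin_cases j <;> simp [Esl2, Hsl2, Ring.lie_def]; norm_num
    rw [lie_loopSl2Action, this, loopSl2Action_smul]
  lie_H_F p q := by
    have : ⁅Hsl2, Fsl2⁆ = (-2 : ℂ) • Fsl2 := by
      ext i j; fin_cases i <;> fin_cases j <;> simp [Fsl2, Hsl2, Ring.lie_def]; norm_num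
    rw [lie_loopSl2Action, this, loopSl2Action_smul]

end Action

end CurrentAlgebra

/-- A linear map out of the Laurent polynomials is determined by its values on monomials. -/
lemma LaurentPolynomial.linearMap_ext {R M : Type*} [CommSemiring R] [AddCommMonoid M] [Module R M]
    {f g : R[T;T⁻¹] →ₗ[R] M} (h : ∀ n, f (T n) = g (T n)) : f = g := by
  refine LinearMap.ext fun p => ?_
  induction p using LaurentPolynomial.induction_on' with
  | add p q hp hq => rw [map_add, map_add, hp, hq]
  | C_mul_T n a => rw [← smul_eq_C_mul, map_smul, map_smul, h]

/-- If `V` is a finite-dimensional `g̃`-module and `v ≠ 0` satisfies `e_r v = 0`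
and `h_s v = ω_s v` for all `r, s ∈ ℤ`, then `ω₀` is a nonnegative integer `λ`
and there exist nonzero `a_1, …, a_λ ∈ ℂ` with `ω_s = a_1^s + ⋯ + a_λ^s` for
all `s ∈ ℤ`. -/
theorem loop_sl2_highestWeight_eigenvalues
    (V : Type*) [AddCommGroup V] [Module ℂ V]
    [LieRingModule loopSl2 V] [LieModule ℂ loopSl2 V] [FiniteDimensional ℂ V]
    (v : V) (hv : v ≠ 0) (ω : ℤ → ℂ)
    (he : ∀ r : ℤ, ⁅(T r : ℂ[T;T⁻¹]) ⊗ₜ[ℂ] Esl2, v⁆ = 0)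
    (hh : ∀ s : ℤ, ⁅(T s : ℂ[T;T⁻¹]) ⊗ₜ[ℂ] Hsl2, v⁆ = ω s • v) :
    ∃ lam : ℕ, ω 0 = (lam : ℂ) ∧
      ∃ a : Fin lam → ℂ, (∀ j, a j ≠ 0) ∧ ∀ s : ℤ, ω s = ∑ j, a j ^ s := by
  obtain ⟨ξ, hξ⟩ := Module.Projective.exists_dual_eq_one ℂ hv
  let ψ : ℂ[T;T⁻¹] →ₗ[ℂ] ℂ :=
    ξ.comp ((LinearMap.applyₗ v).comp (loopSl2Action V Hsl2))
  have hψT (s : ℤ) : ψ (T s) = ω s := by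
    change ξ ⁅(T s : ℂ[T;T⁻¹]) ⊗ₜ[ℂ] Hsl2, v⁆ = ω s
    rw [hh, map_smul, hξ, smul_eq_mul, mul_one]
  have hE : (LinearMap.applyₗ v).comp (loopSl2Action V Esl2) = 0 :=
    LaurentPolynomial.linearMap_ext he
  have hH : (LinearMap.applyₗ v).comp (loopSl2Action V Hsl2) = ψ.smulRight v :=
    LaurentPolynomial.linearMap_ext fun s => by
      rw [LinearMap.smulRight_apply, hψT]
      exact hh s
  obtain ⟨k, φ, hφ⟩ := (isCurrentSl2Rep_loopSl2Action V).exists_eq_sum_algHom hv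
    (LinearMap.congr_fun hE) ψ (LinearMap.congr_fun hH)
  have hunit (j : Fin k) : φ j (T 1) ≠ 0 := ((isUnit_T 1).map (φ j)).ne_zero
  have hpow (j : Fin k) (s : ℤ) : φ j (T s) = φ j (T 1) ^ s := by
    induction s using Int.induction_on with
    | zero => simp
    | succ n ih => rw [T_add, map_mul, ih, zpow_add_one₀ (hunit j)]
    | pred n ih =>
      rw [zpow_sub_one₀ (hunit j), ← ih, eq_mul_inv_iff_mul_eq₀ (hunit j), ← map_mul, ← T_add,
        sub_add_cancel]
  have hω (s : ℤ) : ω s = ∑ j, φ j (T 1) ^ s := by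
    rw [← hψT, hφ]
    exact Finset.sum_congr rfl fun j _ => hpow j s
  exact ⟨k, by simp [hω], fun j => φ j (T 1), hunit, hω⟩
end

section
/- Let g = sl₂(ℂ) and g̃ = ℂ[t,t⁻¹] ⊗ g its loop algebra. Let V and W be finite-dimensional irreducible g-modules with dim V ≥ 2 and dim W ≥ 2, and let a, b be nonzero complex numbers. Regard V as a g̃-module via the evaluation homomorphism ev_a (so t^r ⊗ x acts as a^r·x) and W as a g̃-module via ev_b, and equip V ⊗ W with the tensor-product g̃-module structure, in which y ∈ g̃ acts as y⊗1 + 1⊗y. Then V ⊗ W is an irreducible g̃-module if and only if a ≠ b. -/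
set_option synthInstance.maxHeartbeats 1000000
set_option maxHeartbeats 1000000

open scoped TensorProduct
open LaurentPolynomial LieAlgebra.SpecialLinear

/-- **Burnside's theorem** on matrix algebras: an irreducible algebra of endomorphisms of a
finite-dimensional vector space over an algebraically closed field is the full endomorphism
algebra. -/
theorem Subalgebra.eq_top_of_forall_invariant {K V : Type*} [Field K] [IsAlgClosed K]
    [AddCommGroup V] [Module K V] [FiniteDimensional K V] [Nontrivial V]
    (A : Subalgebra K (Module.End K V))
    (hA : ∀ N : Submodule K V, (∀ φ ∈ A, ∀ v ∈ N, φ v ∈ N) → N = ⊥ ∨ N = ⊤) :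
    A = ⊤ := by
  have hsub (N : Submodule A V) : N = ⊥ ∨ N = ⊤ := by
    refine (hA (N.restrictScalars K) fun φ hφ v hv ↦ N.smul_mem ⟨φ, hφ⟩ hv).imp ?_ ?_ <;>
    simp
  have : IsSimpleModule A V := { eq_bot_or_eq_top := hsub }
  have hscalar (φ : Module.End A V) : ∃ c : K, ∀ v, φ v = c • v := by
    obtain ⟨c, hc⟩ := Module.End.exists_eigenvalue (φ.restrictScalars K : Module.End K V)
    obtain ⟨v, hv⟩ := hc.exists_hasEigenvector
    refine ⟨c, fun w ↦ ?_⟩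
    have hker := (hsub (LinearMap.ker (φ - algebraMap K (Module.End A V) c))).resolve_left fun h ↦
      hv.2 <| by
        rw [← Submodule.mem_bot (R := A), ← h]
        simpa [sub_eq_zero] using hv.apply_eq_smul
    have hw : w ∈ LinearMap.ker (φ - algebraMap K (Module.End A V) c) := hker ▸ Submodule.mem_top
    simpa [sub_eq_zero] using hw
  refine eq_top_iff.2 fun f _ ↦ ?_
  let F : Module.End (Module.End A V) V :=
    { toFun := f
      map_add' := map_add f
      map_smul' := fun φ v ↦ by
        obtain ⟨c, hc⟩ := hscalar φ
        simp [hc] }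
  let b := Module.finBasis K V
  classical
  obtain ⟨r, hr⟩ := jacobson_density F (Finset.univ.image b)
  have : f = r := b.ext fun i ↦ hr (b i) (by simp)
  exact this ▸ r.2

theorem tmul_ne_zero {K V W : Type*} [Field K] [AddCommGroup V] [Module K V]
    [AddCommGroup W] [Module K W] {v : V} {w : W} (hv : v ≠ 0) (hw : w ≠ 0) : v ⊗ₜ[K] w ≠ 0 := by
  obtain ⟨φ, hφ⟩ := not_forall.1 (mt (Module.forall_dual_apply_eq_zero_iff K v).1 hv)
  obtain ⟨ψ, hψ⟩ := not_forall.1 (mt (Module.forall_dual_apply_eq_zero_iff K w).1 hw)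
  intro h
  have hmul := congrArg (fun u ↦ TensorProduct.lid K K (TensorProduct.map φ ψ u)) h
  simp only [TensorProduct.map_tmul, TensorProduct.lid_tmul, map_zero, smul_eq_mul] at hmul
  exact mul_ne_zero hφ hψ hmul

section LieModule

variable {K L V W : Type*} [Field K] [LieRing L] [LieAlgebra K L]
  [AddCommGroup V] [Module K V] [LieRingModule L V] [LieModule K L V]
  [AddCommGroup W] [Module K W] [LieRingModule L W] [LieModule K L W]

/-- A finite-dimensional irreducible representation of a Lie algebra over an algebraically closed
field generates the full endomorphism algebra. -/
theorem LieModule.IsIrreducible.adjoin_range_toEnd [IsAlgClosed K] [FiniteDimensional K V]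
    [LieModule.IsIrreducible K L V] :
    Algebra.adjoin K (Set.range (LieModule.toEnd K L V)) = ⊤ := by
  have : Nontrivial V := (LieSubmodule.nontrivial_iff K L V).1 inferInstance
  refine Subalgebra.eq_top_of_forall_invariant _ fun N hN ↦ ?_
  let N' : LieSubmodule K L V :=
    { N with lie_mem := fun {x v} hv ↦ hN _ (Algebra.subset_adjoin ⟨x, rfl⟩) v hv }
  have key := eq_bot_or_eq_top N'
  rw [← LieSubmodule.toSubmodule_inj, ← LieSubmodule.toSubmodule_inj] at key
  exact key

/-- If the full endomorphism algebra of an irreducible representation `V` acts on `X`, then a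
subspace of `X` stable under the Lie algebra is stable under all endomorphisms of `V`. -/
theorem LieModule.IsIrreducible.algHom_apply_mem [IsAlgClosed K] [FiniteDimensional K V]
    [LieModule.IsIrreducible K L V] {X : Type*} [AddCommGroup X] [Module K X]
    (ρ : Module.End K V →ₐ[K] Module.End K X) {N : Submodule K X}
    (hN : ∀ x : L, ∀ u ∈ N, ρ (LieModule.toEnd K L V x) u ∈ N)
    (φ : Module.End K V) {u : X} (hu : u ∈ N) : ρ φ u ∈ N := by
  have hφ : φ ∈ Algebra.adjoin K (Set.range (LieModule.toEnd K L V)) := by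
    simp [LieModule.IsIrreducible.adjoin_range_toEnd]
  induction hφ using Algebra.adjoin_induction generalizing u with
  | mem φ h => obtain ⟨x, rfl⟩ := h; exact hN x u hu
  | algebraMap c => simpa using N.smul_mem c hu
  | add φ ψ _ _ h₁ h₂ => rw [map_add]; exact N.add_mem (h₁ hu) (h₂ hu)
  | mul φ ψ _ _ h₁ h₂ => rw [map_mul]; exact h₁ (h₂ hu)

/-- The external tensor product of two finite-dimensional irreducible representations over an
algebraically closed field is irreducible. -/
theorem eq_bot_or_eq_top_of_rTensor_lTensor_mem [IsAlgClosed K]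
    [FiniteDimensional K V] [FiniteDimensional K W]
    [LieModule.IsIrreducible K L V] [LieModule.IsIrreducible K L W]
    {N : Submodule K (V ⊗[K] W)}
    (hV : ∀ x : L, ∀ u ∈ N, (LieModule.toEnd K L V x).rTensor W u ∈ N)
    (hW : ∀ x : L, ∀ u ∈ N, (LieModule.toEnd K L W x).lTensor V u ∈ N) :
    N = ⊥ ∨ N = ⊤ := by
  refine or_iff_not_imp_left.2 fun hbot ↦ ?_
  obtain ⟨u, hu, hu0⟩ := N.exists_mem_ne_zero_of_ne_bot hbot
  let bV := Module.finBasis K V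
  let bW := Module.finBasis K W
  let b := bV.tensorProduct bW
  obtain ⟨⟨i, j⟩, hij⟩ : ∃ p, b.repr u p ≠ 0 := by
    by_contra! h
    exact hu0 (b.repr.map_eq_zero_iff.1 (Finsupp.ext h))
  have hmem (v : V) (w : W) : v ⊗ₜ[K] w ∈ N := by
    have key : b.repr u (i, j) • v ⊗ₜ[K] w ∈ N := by
      convert LieModule.IsIrreducible.algHom_apply_mem (Module.End.rTensorAlgHom K V W) hV
        ((bV.coord i).smulRight v)
        (LieModule.IsIrreducible.algHom_apply_mem (Module.End.lTensorAlgHom K W V) hW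
          ((bW.coord j).smulRight w) hu) using 1
      have hmap : (LinearMap.toSpanSingleton K (V ⊗[K] W) (v ⊗ₜ[K] w)) ∘ₗ b.coord (i, j) =
          ((bV.coord i).smulRight v).rTensor W ∘ₗ ((bW.coord j).smulRight w).lTensor V := by
        ext v' w'
        simp only [b, TensorProduct.AlgebraTensorModule.curry_apply, TensorProduct.curry_apply,
          LinearMap.coe_restrictScalars, LinearMap.comp_apply, Module.Basis.coord_apply,
          Module.Basis.tensorProduct_repr_tmul_apply, LinearMap.lTensor_tmul,
          LinearMap.rTensor_tmul, LinearMap.toSpanSingleton_apply, LinearMap.smulRight_apply,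
          TensorProduct.smul_tmul_smul, smul_eq_mul, mul_comm]
      exact LinearMap.congr_fun hmap u
    exact (N.smul_mem_iff hij).1 key
  rw [eq_top_iff, ← TensorProduct.span_tmul_eq_top, Submodule.span_le]
  rintro _ ⟨v, w, rfl⟩
  exact hmem v w

variable (K V W) in
/-- Twice the polarised Casimir operator `e ⊗ f + f ⊗ e + ½ h ⊗ h` of `sl₂` on `V ⊗ W`. -/
noncomputable def splitCasimir (h e f : L) : Module.End K (V ⊗[K] W) :=
  let ρ := LieModule.toEnd K L V
  let σ := LieModule.toEnd K L W
  (2 : K) • TensorProduct.map (ρ e) (σ f) + (2 : K) • TensorProduct.map (ρ f) (σ e) +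
    TensorProduct.map (ρ h) (σ h)

theorem splitCasimir_tmul (h e f : L) (v : V) (w : W) :
    splitCasimir K V W h e f (v ⊗ₜ w) =
      (2 : K) • ⁅e, v⁆ ⊗ₜ[K] ⁅f, w⁆ + (2 : K) • ⁅f, v⁆ ⊗ₜ[K] ⁅e, w⁆ + ⁅h, v⁆ ⊗ₜ[K] ⁅h, w⁆ := by
  simp [splitCasimir]

variable {h e f : L}

theorem IsSl2Triple.lie_e_splitCasimir (t : IsSl2Triple h e f) (u : V ⊗[K] W) :
    ⁅e, splitCasimir K V W h e f u⁆ = splitCasimir K V W h e f ⁅e, u⁆ := by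
  induction u with
  | zero => simp
  | add u₁ u₂ h₁ h₂ => simp only [map_add, lie_add, h₁, h₂]
  | tmul v w =>
    have hehv : ⁅e, ⁅h, v⁆⁆ = ⁅h, ⁅e, v⁆⁆ - (2 : K) • ⁅e, v⁆ := by
      rw [leibniz_lie h, t.lie_h_e_smul K, smul_lie]; abel
    have hehw : ⁅e, ⁅h, w⁆⁆ = ⁅h, ⁅e, w⁆⁆ - (2 : K) • ⁅e, w⁆ := by
      rw [leibniz_lie h, t.lie_h_e_smul K, smul_lie]; abel
    have hefv : ⁅e, ⁅f, v⁆⁆ = ⁅h, v⁆ + ⁅f, ⁅e, v⁆⁆ := by rw [leibniz_lie, t.lie_e_f]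
    have hefw : ⁅e, ⁅f, w⁆⁆ = ⁅h, w⁆ + ⁅f, ⁅e, w⁆⁆ := by rw [leibniz_lie, t.lie_e_f]
    simp only [splitCasimir_tmul, TensorProduct.LieModule.lie_tmul_right, map_add, lie_add,
      lie_smul, hehv, hehw, hefv, hefw, TensorProduct.add_tmul, TensorProduct.tmul_add,
      TensorProduct.sub_tmul, TensorProduct.tmul_sub, TensorProduct.tmul_smul,
      ← TensorProduct.smul_tmul']
    module

theorem splitCasimir_symm (u : V ⊗[K] W) :
    splitCasimir K V W (-h) f e u = splitCasimir K V W h e f u := by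
  induction u with
  | zero => simp
  | add u₁ u₂ h₁ h₂ => simp only [map_add, h₁, h₂]
  | tmul v w =>
    simp only [splitCasimir_tmul, neg_lie, TensorProduct.neg_tmul, TensorProduct.tmul_neg]
    module

theorem IsSl2Triple.lie_f_splitCasimir (t : IsSl2Triple h e f) (u : V ⊗[K] W) :
    ⁅f, splitCasimir K V W h e f u⁆ = splitCasimir K V W h e f ⁅f, u⁆ := by
  simpa only [splitCasimir_symm] using t.symm.lie_e_splitCasimir u

theorem IsSl2Triple.lie_h_splitCasimir (t : IsSl2Triple h e f) (u : V ⊗[K] W) :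
    ⁅h, splitCasimir K V W h e f u⁆ = splitCasimir K V W h e f ⁅h, u⁆ := by
  have hlie (u : V ⊗[K] W) : ⁅h, u⁆ = ⁅e, ⁅f, u⁆⁆ - ⁅f, ⁅e, u⁆⁆ := by rw [← t.lie_e_f, lie_lie]
  rw [hlie, hlie, t.lie_f_splitCasimir, t.lie_e_splitCasimir, t.lie_e_splitCasimir,
    t.lie_f_splitCasimir, map_sub]

end LieModule

theorem isSl2Triple_sl2 : IsSl2Triple Hsl2 Esl2 Fsl2 where
  h_ne_zero h := by simpa [Hsl2] using congrArg (fun x ↦ x.1 0 0) h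
  lie_e_f := by
    ext i j; fin_cases i <;> fin_cases j <;>
      simp [Hsl2, Esl2, Fsl2, LieRing.of_associative_ring_bracket]
  lie_h_e_nsmul := by
    ext i j; fin_cases i <;> fin_cases j <;>
      norm_num [Hsl2, Esl2, LieRing.of_associative_ring_bracket]
  lie_h_f_nsmul := by
    ext i j; fin_cases i <;> fin_cases j <;>
      norm_num [Hsl2, Fsl2, LieRing.of_associative_ring_bracket]

theorem sl2_eq_smul_add_smul_add_smul (x : sl (Fin 2) ℂ) :
    x = x.1 0 1 • Esl2 + x.1 1 0 • Fsl2 + x.1 0 0 • Hsl2 := by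
  have hx : x.1 1 1 = -x.1 0 0 := by
    have : x.1.trace = 0 := x.2
    rw [Matrix.trace_fin_two] at this
    linear_combination this
  ext i j; fin_cases i <;> fin_cases j <;> simp [Hsl2, Esl2, Fsl2, hx]

section Sl2Module

variable {V W : Type*} [AddCommGroup V] [Module ℂ V] [AddCommGroup W] [Module ℂ W]
  [LieRingModule (sl (Fin 2) ℂ) V] [LieModule ℂ (sl (Fin 2) ℂ) V]
  [LieRingModule (sl (Fin 2) ℂ) W] [LieModule ℂ (sl (Fin 2) ℂ) W]

theorem lie_splitCasimir_sl2 (x : sl (Fin 2) ℂ) (u : V ⊗[ℂ] W) :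
    ⁅x, splitCasimir ℂ V W Hsl2 Esl2 Fsl2 u⁆ = splitCasimir ℂ V W Hsl2 Esl2 Fsl2 ⁅x, u⁆ := by
  have t := isSl2Triple_sl2
  rw [sl2_eq_smul_add_smul_add_smul x]
  simp only [add_lie, smul_lie, map_add, map_smul, t.lie_e_splitCasimir, t.lie_f_splitCasimir,
    t.lie_h_splitCasimir]

variable [FiniteDimensional ℂ V] [FiniteDimensional ℂ W]

variable (V) in
/-- An irreducible `sl₂`-module of dimension at least two has a primitive vector of nonzero
weight. -/
theorem exists_hasPrimitiveVectorWith_ne_zero [LieModule.IsIrreducible ℂ (sl (Fin 2) ℂ) V]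
    (hV : 2 ≤ Module.finrank ℂ V) :
    ∃ (μ : ℂ) (v : V), μ ≠ 0 ∧ isSl2Triple_sl2.HasPrimitiveVectorWith v μ := by
  have : Nontrivial V := Module.nontrivial_of_finrank_pos (R := ℂ) (by lia)
  obtain ⟨μ, v, hv, P⟩ := isSl2Triple_sl2.exists_hasPrimitiveVectorWith (R := ℂ) (M := V)
  refine ⟨μ, v, ?_, P⟩
  rintro rfl
  have hf : ⁅Fsl2, v⁆ = 0 := by simpa using P.pow_toEnd_f_eq_zero_of_eq_nat (n := 0) (by simp)
  have hx (x : sl (Fin 2) ℂ) : ⁅x, v⁆ = 0 := by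
    rw [sl2_eq_smul_add_smul_add_smul x]
    simp [hf, P.lie_e, P.lie_h]
  let N : LieSubmodule ℂ (sl (Fin 2) ℂ) V :=
    { Submodule.span ℂ {v} with
      lie_mem := fun {x m} hm ↦ by
        obtain ⟨c, rfl⟩ := Submodule.mem_span_singleton.1 hm
        simp [hx] }
  have hvN : v ∈ N := Submodule.mem_span_singleton_self v
  have hN : N = ⊤ := (eq_bot_or_eq_top N).resolve_left fun h ↦ hv (by simpa [h] using hvN)
  have hspan : Submodule.span ℂ {v} = ⊤ := congrArg LieSubmodule.toSubmodule hN
  have := finrank_span_singleton (K := ℂ) hv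
  rw [hspan, finrank_top] at this
  lia

/-- The tensor product of two irreducible `sl₂`-modules of dimension at least two is reducible. -/
theorem not_isIrreducible_tensorProduct_sl2
    [LieModule.IsIrreducible ℂ (sl (Fin 2) ℂ) V] [LieModule.IsIrreducible ℂ (sl (Fin 2) ℂ) W]
    (hV : 2 ≤ Module.finrank ℂ V) (hW : 2 ≤ Module.finrank ℂ W) :
    ¬ LieModule.IsIrreducible ℂ (sl (Fin 2) ℂ) (V ⊗[ℂ] W) := by
  intro hirr
  obtain ⟨μ, v, hμ, P⟩ := exists_hasPrimitiveVectorWith_ne_zero V hV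
  obtain ⟨ν, w, hν, Q⟩ := exists_hasPrimitiveVectorWith_ne_zero W hW
  let N : LieSubmodule ℂ (sl (Fin 2) ℂ) (V ⊗[ℂ] W) :=
    { Module.End.eigenspace (splitCasimir ℂ V W Hsl2 Esl2 Fsl2) (μ * ν) with
      lie_mem := fun {x u} hu ↦ by
        have hu' := Module.End.mem_eigenspace_iff.1 hu
        refine Module.End.mem_eigenspace_iff.2 ?_
        rw [← lie_splitCasimir_sl2, hu', lie_smul] }
  have hmemN (u : V ⊗[ℂ] W) :
      u ∈ N ↔ splitCasimir ℂ V W Hsl2 Esl2 Fsl2 u = (μ * ν) • u :=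
    Module.End.mem_eigenspace_iff
  have hvw : v ⊗ₜ w ∈ N := by
    simp [hmemN, splitCasimir_tmul, P.lie_e, P.lie_h, Q.lie_e, Q.lie_h, mul_smul, smul_comm μ,
      ← TensorProduct.smul_tmul']
  have hvw0 : v ⊗ₜ[ℂ] w ≠ 0 := tmul_ne_zero P.ne_zero Q.ne_zero
  have hN : N = ⊤ := (eq_bot_or_eq_top N).resolve_left fun h ↦ hvw0 (by simpa [h] using hvw)
  have hfv : ⁅Esl2, ⁅Fsl2, v⁆⁆ = μ • v := by simpa using P.lie_e_pow_succ_toEnd_f 0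
  have hhfv : ⁅Hsl2, ⁅Fsl2, v⁆⁆ = (μ - 2) • ⁅Fsl2, v⁆ := by simpa using P.lie_h_pow_toEnd_f 1
  have key := (hmemN (⁅Fsl2, v⁆ ⊗ₜ w)).1 (hN ▸ LieSubmodule.mem_top _)
  rw [splitCasimir_tmul, hfv, hhfv, Q.lie_e, Q.lie_h] at key
  -- Applying `e ⊗ 1` isolates the term `v ⊗ w`.
  have key' := congrArg (TensorProduct.map (LieModule.toEnd ℂ (sl (Fin 2) ℂ) V Esl2)
    LinearMap.id) key
  simp only [map_add, map_smul, map_zero, TensorProduct.map_tmul, LinearMap.id_apply,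
    LieModule.toEnd_apply_apply, P.lie_e, hfv, TensorProduct.tmul_zero, TensorProduct.zero_tmul,
    TensorProduct.tmul_smul, ← TensorProduct.smul_tmul', smul_zero, zero_add] at key'
  have hzero : (2 * μ * ν) • v ⊗ₜ[ℂ] w = 0 := by
    linear_combination (norm := module) -key'
  exact smul_ne_zero (by simp [hμ, hν]) hvw0 hzero

end Sl2Module

/-- A subspace is stable under the loop algebra as soon as it is stable under all `tʳ ⊗ x`. -/
theorem loopSl2_lie_mem {M : Type*} [AddCommGroup M] [Module ℂ M] [LieRingModule loopSl2 M]
    [LieModule ℂ loopSl2 M] {N : Submodule ℂ M}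
    (hN : ∀ (r : ℤ) (x : sl (Fin 2) ℂ), ∀ m ∈ N, ⁅(T r : ℂ[T;T⁻¹]) ⊗ₜ[ℂ] x, m⁆ ∈ N)
    (y : loopSl2) {m : M} (hm : m ∈ N) : ⁅y, m⁆ ∈ N := by
  induction y using TensorProduct.induction_on with
  | zero => simp
  | add y₁ y₂ h₁ h₂ => rw [add_lie]; exact N.add_mem h₁ h₂
  | tmul p x =>
    induction p using LaurentPolynomial.induction_on' with
    | add p q hp hq => rw [TensorProduct.add_tmul, add_lie]; exact N.add_mem hp hq
    | C_mul_T n c =>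
      rw [← LaurentPolynomial.smul_eq_C_mul, ← TensorProduct.smul_tmul']
      exact (smul_lie c ((T n : ℂ[T;T⁻¹]) ⊗ₜ[ℂ] x) m).symm ▸ N.smul_mem c (hN n x m hm)

/-- Let `V`, `W` be finite-dimensional irreducible `sl₂(ℂ)`-modules of dimension
at least 2, and `a, b ∈ ℂˣ`. Give `V ⊗ W` the `g̃`-module structure in which
`tʳ ⊗ x` acts by `aʳ x ⊗ 1 + 1 ⊗ bʳ x` (the tensor product of the evaluation
modules at `a` and `b`). Then `V ⊗ W` is irreducible iff `a ≠ b`. -/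
theorem evaluation_tensor_irreducible_iff
    (V W : Type*) [AddCommGroup V] [Module ℂ V] [AddCommGroup W] [Module ℂ W]
    [LieRingModule (sl (Fin 2) ℂ) V] [LieModule ℂ (sl (Fin 2) ℂ) V]
    [LieRingModule (sl (Fin 2) ℂ) W] [LieModule ℂ (sl (Fin 2) ℂ) W]
    [FiniteDimensional ℂ V] [FiniteDimensional ℂ W]
    [LieModule.IsIrreducible ℂ (sl (Fin 2) ℂ) V]
    [LieModule.IsIrreducible ℂ (sl (Fin 2) ℂ) W]
    (hV : 2 ≤ Module.finrank ℂ V) (hW : 2 ≤ Module.finrank ℂ W)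
    (a b : ℂ) (ha : a ≠ 0) (hb : b ≠ 0)
    [LieRingModule loopSl2 (V ⊗[ℂ] W)] [LieModule ℂ loopSl2 (V ⊗[ℂ] W)]
    (haction : ∀ (r : ℤ) (x : sl (Fin 2) ℂ) (v : V) (w : W),
      ⁅(T r : ℂ[T;T⁻¹]) ⊗ₜ[ℂ] x, v ⊗ₜ[ℂ] w⁆ =
        a ^ r • (⁅x, v⁆ ⊗ₜ[ℂ] w) + b ^ r • (v ⊗ₜ[ℂ] ⁅x, w⁆)) :
    LieModule.IsIrreducible ℂ loopSl2 (V ⊗[ℂ] W) ↔ a ≠ b := by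
  have hnontriv : Nontrivial (V ⊗[ℂ] W) := Module.nontrivial_of_finrank_pos (R := ℂ) <| by
    rw [Module.finrank_tensorProduct]; positivity
  constructor
  · rintro hirr rfl
    have hact (r : ℤ) (x : sl (Fin 2) ℂ) (u : V ⊗[ℂ] W) :
        ⁅(T r : ℂ[T;T⁻¹]) ⊗ₜ[ℂ] x, u⁆ = a ^ r • ⁅x, u⁆ := by
      induction u with
      | zero => simp
      | add u₁ u₂ h₁ h₂ => simp only [lie_add, smul_add, h₁, h₂]
      | tmul v w => rw [haction, TensorProduct.LieModule.lie_tmul_right, smul_add]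
    refine not_isIrreducible_tensorProduct_sl2 hV hW (.mk fun N hN ↦ ?_)
    let N' : LieSubmodule ℂ loopSl2 (V ⊗[ℂ] W) :=
      { N.toSubmodule with
        lie_mem := fun {y u} hu ↦ loopSl2_lie_mem (N := N.toSubmodule)
          (fun r x m hm ↦ by
            rw [hact]
            exact N.toSubmodule.smul_mem _ (N.lie_mem hm)) y hu }
    have key := eq_bot_or_eq_top N'
    rw [← LieSubmodule.toSubmodule_inj, ← LieSubmodule.toSubmodule_inj] at key
    rw [ne_eq, ← LieSubmodule.toSubmodule_inj] at hN
    rw [← LieSubmodule.toSubmodule_inj]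
    exact key.resolve_left hN
  · intro hab
    refine .mk fun N hN ↦ ?_
    have hact (r : ℤ) (x : sl (Fin 2) ℂ) (u : V ⊗[ℂ] W) :
        ⁅(T r : ℂ[T;T⁻¹]) ⊗ₜ[ℂ] x, u⁆ =
          a ^ r • (LieModule.toEnd ℂ _ V x).rTensor W u +
            b ^ r • (LieModule.toEnd ℂ _ W x).lTensor V u := by
      induction u with
      | zero => simp
      | add u₁ u₂ h₁ h₂ => simp only [lie_add, map_add, smul_add, h₁, h₂]; abel
      | tmul v w => simp [haction]
    rw [ne_eq, ← LieSubmodule.toSubmodule_inj] at hN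
    rw [← LieSubmodule.toSubmodule_inj]
    have hmem (r : ℤ) (x : sl (Fin 2) ℂ) {u : V ⊗[ℂ] W} (hu : u ∈ N.toSubmodule) :
        a ^ r • (LieModule.toEnd ℂ _ V x).rTensor W u +
            b ^ r • (LieModule.toEnd ℂ _ W x).lTensor V u ∈ N.toSubmodule := by
      rw [← hact]; exact N.lie_mem hu
    refine (eq_bot_or_eq_top_of_rTensor_lTensor_mem (L := sl (Fin 2) ℂ) (fun x u hu ↦ ?_)
      fun x u hu ↦ ?_).resolve_left hN
    · rw [← N.toSubmodule.smul_mem_iff (sub_ne_zero.2 hab)]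
      convert N.toSubmodule.sub_mem (hmem 1 x hu) (N.toSubmodule.smul_mem b (hmem 0 x hu)) using 1
      simp only [zpow_one, zpow_zero]
      module
    · rw [← N.toSubmodule.smul_mem_iff (sub_ne_zero.2 hab.symm)]
      convert N.toSubmodule.sub_mem (hmem 1 x hu) (N.toSubmodule.smul_mem a (hmem 0 x hu)) using 1
      simp only [zpow_one, zpow_zero]
      module
end

section
/- Let g = sl₂(ℂ) with standard basis e, f, h, let g̃ = ℂ[t,t⁻¹] ⊗ g be its loop algebra, and write x_r = ι(t^r ⊗ x) ∈ U(g̃). Let λ be a nonnegative integer, a_1, …, a_λ nonzero complex numbers, ω_s = a_1^s + ⋯ + a_λ^s for s ∈ ℤ, and let I be the left ideal of U(g̃) generated by the elements e_r (r ∈ ℤ), h_s − ω_s·1 (s ∈ ℤ), and (f_r)^{λ+1} (r ∈ ℤ). Then the quotient U(g̃)/I is spanned over ℂ by the image of 1 together with the images of the monomials f_{s_1}·f_{s_2}·⋯·f_{s_N} with 1 ≤ N ≤ λ and 0 ≤ s_j ≤ λ−1 for all j. -/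
set_option synthInstance.maxHeartbeats 1000000
set_option maxHeartbeats 1000000

open scoped TensorProduct
open LaurentPolynomial LieAlgebra.SpecialLinear

/-- The universal enveloping algebra `U(g̃)`. -/
abbrev Ug : Type := UniversalEnvelopingAlgebra ℂ loopSl2

/-- `e_r = ι(tʳ ⊗ e) ∈ U(g̃)`. -/
noncomputable def Eel (r : ℤ) : Ug :=
  UniversalEnvelopingAlgebra.ι ℂ ((T r : ℂ[T;T⁻¹]) ⊗ₜ[ℂ] Esl2)

/-- `f_r = ι(tʳ ⊗ f) ∈ U(g̃)`. -/
noncomputable def Fel (r : ℤ) : Ug :=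
  UniversalEnvelopingAlgebra.ι ℂ ((T r : ℂ[T;T⁻¹]) ⊗ₜ[ℂ] Fsl2)

/-- `h_r = ι(tʳ ⊗ h) ∈ U(g̃)`. -/
noncomputable def Hel (r : ℤ) : Ug :=
  UniversalEnvelopingAlgebra.ι ℂ ((T r : ℂ[T;T⁻¹]) ⊗ₜ[ℂ] Hsl2)

/-- The defining left ideal of the Weyl module `W(ω)` attached to the Drinfeld
polynomial `ω(u) = ∏ⱼ (1 − aⱼu)`: it is generated by the `e_r`, the
`h_s − ω_s·1` where `ω_s = ∑ⱼ aⱼˢ`, and the `f_r^{λ+1}`. -/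
noncomputable def weylIdeal (lam : ℕ) (a : Fin lam → ℂ) : Ideal Ug :=
  Ideal.span ({x : Ug | ∃ r : ℤ, x = Eel r} ∪
    {x : Ug | ∃ s : ℤ, x = Hel s - algebraMap ℂ Ug (∑ j, a j ^ s)} ∪
    {x : Ug | ∃ r : ℤ, x = Fel r ^ (lam + 1)})

namespace PowerSeries

variable {R : Type*} [Ring R]

/-- The Euler operator `u d/du` on power series over a not necessarily commutative ring. -/
noncomputable def euler (φ : R⟦X⟧) : R⟦X⟧ := mk fun n => (n : R) * coeff n φ

@[simp]
theorem coeff_euler (φ : R⟦X⟧) (n : ℕ) : coeff n (euler φ) = (n : R) * coeff n φ :=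
  coeff_mk _ _

theorem euler_mul (φ ψ : R⟦X⟧) : euler (φ * ψ) = euler φ * ψ + φ * euler ψ := by
  ext n
  simp only [coeff_euler, map_add, coeff_mul, Finset.mul_sum, ← Finset.sum_add_distrib]
  refine Finset.sum_congr rfl fun p hp => ?_
  rw [← Finset.HasAntidiagonal.mem_antidiagonal.mp hp, Nat.cast_add, ← mul_assoc (coeff p.1 φ),
    ← (Nat.cast_commute p.2 (coeff p.1 φ)).eq]
  noncomm_ring

@[simp]
theorem euler_one : euler (1 : R⟦X⟧) = 0 := by
  ext n
  rcases n with _ | n <;> simp [coeff_one]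

theorem commute_of_coeff {φ ψ : R⟦X⟧} (h : ∀ m n, Commute (coeff m φ) (coeff n ψ)) :
    Commute φ ψ := by
  ext n
  rw [coeff_mul, coeff_mul, ← Finset.Nat.sum_antidiagonal_swap]
  exact Finset.sum_congr rfl fun p _ => (h _ _).eq

theorem euler_pow_mul_self {φ : R⟦X⟧} (h : Commute φ (euler φ)) (m : ℕ) :
    euler (φ ^ m) * φ = (m : R⟦X⟧) * (φ ^ m * euler φ) := by
  induction m with
  | zero => simp
  | succ m ih =>
    have h' : φ ^ m * euler φ * φ = φ ^ (m + 1) * euler φ := by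
      rw [mul_assoc, ← h.eq, ← mul_assoc, pow_succ]
    rw [pow_succ, euler_mul, ih, add_mul, mul_assoc, h', Nat.cast_succ, ← pow_succ]
    noncomm_ring

theorem coeff_mul_mem {I : Ideal R} (φ : R⟦X⟧) {ψ : R⟦X⟧} (h : ∀ n, coeff n ψ ∈ I) (n : ℕ) :
    coeff n (φ * ψ) ∈ I := by
  rw [coeff_mul]
  exact sum_mem fun p _ => I.mul_mem_left _ (h _)

variable {K ι : Type*} [Field K]

/-- The series `∑ a ^ n * u ^ n` over `n ≥ 1` is `a u / (1 - a u)`. -/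
theorem mk_pow_succ_mul (a : K) :
    (X * mk fun n => a ^ (n + 1)) * (1 - C a * X) = C a * X := by
  ext n
  rw [mul_sub, mul_one, map_sub, ← mul_assoc, mul_comm _ (C a), mul_assoc, coeff_C_mul, coeff_C_mul]
  rcases n with _ | n
  · simp
  · rw [coeff_succ_X_mul, coeff_mk, coeff_succ_mul_X, coeff_X]
    rcases n with _ | n
    · simp
    · rw [coeff_succ_X_mul, coeff_mk]
      simp [pow_succ']

theorem euler_one_sub_C_mul_X (a : K) : euler (1 - C a * X) = -(C a * X) := by
  ext n
  rcases n with _ | _ | n <;> simp [coeff_one]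

/-- Newton's identities, as a differential equation for `∏ (1 - aⱼ u)`. -/
theorem euler_prod_one_sub (s : Finset ι) (a : ι → K) :
    (∑ j ∈ s, X * mk fun n => a j ^ (n + 1)) * ∏ j ∈ s, (1 - C (a j) * X)
      = -euler (∏ j ∈ s, (1 - C (a j) * X)) := by
  classical
  induction s using Finset.induction_on with
  | empty => simp
  | insert i s hi ih =>
    rw [Finset.sum_insert hi, Finset.prod_insert hi, euler_mul, euler_one_sub_C_mul_X]
    linear_combination (∏ j ∈ s, (1 - C (a j) * X)) * mk_pow_succ_mul (a i) + (1 - C (a i) * X) * ih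

end PowerSeries

/-- The relations satisfied by `e_r`, `f_r`, `h_r` in the enveloping algebra of the loop algebra
of `sl₂` (those among the `h_r`, among the `e_r` and between `h_r` and `e_s` are not included). -/
structure IsLoopTriple {U : Type*} [Ring U] (e f h : ℤ → U) : Prop where
  e_mul_f (r s : ℤ) : e r * f s = f s * e r + h (r + s)
  h_mul_f (r s : ℤ) : h r * f s = f s * h r - 2 * f (r + s)
  commute_f (r s : ℤ) : Commute (f r) (f s)

namespace IsLoopTriple

open PowerSeries

variable {U : Type*} [Ring U] {e f h : ℤ → U} (H : IsLoopTriple e f h)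

/-- The generating series `∑ f_n u ^ (n + 1)`. -/
noncomputable def fSeries (f : ℤ → U) : U⟦X⟧ := X * PowerSeries.mk fun n => f n

/-- The generating series `∑ h_(n+1) u ^ (n + 1)`. -/
noncomputable def hSeries (h : ℤ → U) : U⟦X⟧ := X * PowerSeries.mk fun n => h (n + 1 : ℕ)

@[simp]
theorem constantCoeff_fSeries : constantCoeff (fSeries f) = 0 := by simp [fSeries]

@[simp]
theorem coeff_succ_fSeries (n : ℕ) : coeff (n + 1) (fSeries f) = f n := by
  rw [fSeries, coeff_succ_X_mul, coeff_mk]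

@[simp]
theorem constantCoeff_hSeries : constantCoeff (hSeries h) = 0 := by simp [hSeries]

@[simp]
theorem coeff_succ_hSeries (n : ℕ) : coeff (n + 1) (hSeries h) = h (n + 1 : ℕ) := by
  rw [hSeries, coeff_succ_X_mul, coeff_mk]

include H

theorem C_mul_fSeries :
    PowerSeries.C (e 1) * fSeries f = fSeries f * PowerSeries.C (e 1) + hSeries h := by
  ext n
  rcases n with _ | n
  · simp
  · simp [H.e_mul_f, add_comm]

theorem commute_euler_fSeries : Commute (fSeries f) (euler (fSeries f)) := by
  refine commute_of_coeff fun m n => ?_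
  rw [coeff_euler]
  refine (Nat.commute_cast _ n).mul_right ?_
  rcases m with _ | m
  · simp
  rcases n with _ | n
  · simp
  simpa using H.commute_f m n

theorem hSeries_mul_fSeries :
    hSeries h * fSeries f = fSeries f * hSeries h - 2 * (euler (fSeries f) - fSeries f) := by
  ext n
  have h2 : ∀ φ : U⟦X⟧, coeff n (2 * φ) = 2 * coeff n φ := fun φ => by
    rw [two_mul, two_mul, map_add]
  rw [map_sub, h2, map_sub, coeff_euler]
  rcases n with _ | n
  · simp [coeff_mul]
  have key : ∀ p ∈ Finset.HasAntidiagonal.antidiagonal n,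
      coeff p.1 (PowerSeries.mk fun n : ℕ => h (n + 1 : ℕ)) * coeff p.2 (fSeries f) =
        coeff p.2 (fSeries f) * coeff p.1 (PowerSeries.mk fun n : ℕ => h (n + 1 : ℕ))
          - if p.2 = 0 then 0 else 2 * f n := by
    rintro ⟨i, j⟩ hp
    rcases j with _ | j
    · simp
    · rw [← Finset.HasAntidiagonal.mem_antidiagonal.mp hp]
      simp only [coeff_mk, coeff_succ_fSeries, H.h_mul_f]
      simp only [Nat.add_eq_zero_iff, one_ne_zero, and_false, if_false]
      congr 3
      push_cast
      ring
  have e1 : coeff (n + 1) (hSeries h * fSeries f) =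
      ∑ p ∈ Finset.HasAntidiagonal.antidiagonal n,
        coeff p.1 (PowerSeries.mk fun n : ℕ => h (n + 1 : ℕ)) * coeff p.2 (fSeries f) := by
    rw [hSeries, mul_assoc, coeff_succ_X_mul, coeff_mul]
  have e2 : coeff (n + 1) (fSeries f * hSeries h) =
      ∑ p ∈ Finset.HasAntidiagonal.antidiagonal n, coeff p.2 (fSeries f) *
        coeff p.1 (PowerSeries.mk fun n : ℕ => h (n + 1 : ℕ)) := by
    rw [hSeries, ← mul_assoc, ← X_mul, mul_assoc, coeff_succ_X_mul, coeff_mul,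
      ← Finset.Nat.sum_antidiagonal_swap]
    rfl
  rw [e1, e2, Finset.sum_congr rfl key, Finset.sum_sub_distrib]
  congr 1
  rw [Finset.Nat.sum_antidiagonal_eq_sum_range_succ_mk, ← Finset.sum_range_reflect,
    Finset.sum_range_succ']
  have : ∀ k ∈ Finset.range n,
      (if n - (n + 1 - 1 - (k + 1)) = 0 then (0 : U) else 2 * f n) = 2 * f n := by
    intro k hk
    rw [if_neg]
    have := Finset.mem_range.mp hk
    omega
  rw [Finset.sum_congr rfl this, coeff_succ_fSeries]
  simp
  noncomm_ring

theorem hSeries_mul_fSeries_pow (m : ℕ) :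
    hSeries h * fSeries f ^ m = fSeries f ^ m * hSeries h
      - 2 * (euler (fSeries f ^ m) - (m : U⟦X⟧) * fSeries f ^ m) := by
  induction m with
  | zero => simp
  | succ m ih =>
    rw [pow_succ, ← mul_assoc, ih, euler_mul, sub_mul, mul_assoc _ (hSeries h),
      H.hSeries_mul_fSeries, Nat.cast_succ]
    noncomm_ring

/-- Garland's commutation formula in `U⟦u⟧`. -/
theorem C_mul_fSeries_pow (m : ℕ) :
    PowerSeries.C (e 1) * fSeries f ^ (m + 1) = fSeries f ^ (m + 1) * PowerSeries.C (e 1)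
      + (m + 1 : ℕ) * (fSeries f ^ m * hSeries h - euler (fSeries f ^ m)
        + (m : U⟦X⟧) * fSeries f ^ m) := by
  induction m with
  | zero => simp [H.C_mul_fSeries]
  | succ m ih =>
    set F := fSeries f with hF
    have hc := euler_pow_mul_self H.commute_euler_fSeries m
    have hE : euler (F ^ (m + 1)) = (m + 1 : ℕ) * (F ^ m * euler F) := by
      rw [pow_succ, euler_mul, hc]
      push_cast
      noncomm_ring
    have hFm : F * euler (F ^ m) = (m : U⟦X⟧) * (F ^ m * euler F) := by
      have : euler (F * F ^ m) = euler (F ^ m * F) := by rw [← pow_succ, ← pow_succ']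
      rw [euler_mul, euler_mul, (H.commute_euler_fSeries.symm.pow_right m).eq, ← hF] at this
      rw [← hc, ← hF]
      rw [add_comm] at this
      exact add_right_cancel this
    have hcast : F * ((m + 1 : ℕ) : U⟦X⟧) = ((m + 1 : ℕ) : U⟦X⟧) * F :=
      (Nat.cast_commute _ F).eq.symm
    have hcast' : F * (m : U⟦X⟧) = (m : U⟦X⟧) * F := (Nat.cast_commute _ F).eq.symm
    calc PowerSeries.C (e 1) * F ^ (m + 1 + 1)
        = F * (PowerSeries.C (e 1) * F ^ (m + 1)) + hSeries h * F ^ (m + 1) := by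
          rw [pow_succ' F (m + 1), ← mul_assoc, hF, H.C_mul_fSeries]; noncomm_ring
      _ = F ^ (m + 1 + 1) * PowerSeries.C (e 1) + (m + 1 : ℕ) * (F ^ (m + 1) * hSeries h
            - F * euler (F ^ m) + (m : U⟦X⟧) * F ^ (m + 1)) + hSeries h * F ^ (m + 1) := by
          rw [ih, mul_add, ← mul_assoc F (_ : U⟦X⟧) (_ - _ + _), hcast, mul_assoc, mul_add F (_ - _),
            ← mul_assoc F (m : U⟦X⟧), hcast', pow_succ' F (m + 1), pow_succ' F m]
          noncomm_ring
      _ = _ := by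
          rw [hF, H.hSeries_mul_fSeries_pow, ← hF, hFm, hE]
          push_cast
          noncomm_ring


theorem h_mul_f_pow (r s : ℤ) (m : ℕ) :
    h s * f r ^ (m + 1) = f r ^ (m + 1) * h s - (2 * (m + 1) : ℕ) * (f (s + r) * f r ^ m) := by
  induction m with
  | zero => simp [H.h_mul_f]
  | succ m ih =>
    have hc : f r ^ (m + 1) * f (s + r) = f (s + r) * f r ^ (m + 1) :=
      ((H.commute_f (s + r) r).pow_right (m + 1)).eq.symm
    rw [pow_succ, ← mul_assoc, ih, sub_mul, mul_assoc, H.h_mul_f, mul_assoc _ (_ * _) (f r),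
      mul_assoc (f (s + r)), ← pow_succ, mul_sub, ← mul_assoc _ (f r) (h s), ← pow_succ, two_mul,
      mul_add, hc]
    push_cast
    noncomm_ring

theorem ad_h_prod_mem (s : ℤ) (l : List ℤ) (N : AddSubgroup U)
    (hN : ∀ l' : List ℤ, l'.length = l.length → (l'.map f).prod ∈ N) :
    h s * (l.map f).prod - (l.map f).prod * h s ∈ N := by
  induction l generalizing N with
  | nil => simp
  | cons a l ih =>
    have h1 := ih (N.comap (AddMonoidHom.mulLeft (f a))) fun l' hl' => by
      simpa using hN (a :: l') (by simp [hl'])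
    have h2 := hN ((s + a) :: l) (by simp)
    have h3 : h s * ((a :: l).map f).prod - ((a :: l).map f).prod * h s =
        f a * (h s * (l.map f).prod - (l.map f).prod * h s)
          - (((s + a) :: l).map f).prod - (((s + a) :: l).map f).prod := by
      simp only [List.map_cons, List.prod_cons]
      rw [← mul_assoc, H.h_mul_f]
      noncomm_ring
    rw [h3]
    exact sub_mem (sub_mem h1 h2) h2

variable {K : Type*} [Field K] [Algebra K U] {I : Ideal U} {ω : ℤ → K}

omit H in
theorem algebraMap_mul_mem_iff {c : K} (hc : c ≠ 0) {x : U} : algebraMap K U c * x ∈ I ↔ x ∈ I := by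
  refine ⟨fun hx => ?_, I.mul_mem_left _⟩
  have := I.mul_mem_left (algebraMap K U c⁻¹) hx
  rwa [← mul_assoc, ← map_mul, inv_mul_cancel₀ hc, map_one, one_mul] at this

omit H in
theorem natCast_mul_mem_iff [CharZero K] {n : ℕ} (hn : n ≠ 0) {x : U} :
    (n : U) * x ∈ I ↔ x ∈ I := by
  rw [← map_natCast (algebraMap K U)]
  exact algebraMap_mul_mem_iff (Nat.cast_ne_zero.mpr hn)

omit H in
theorem ad_h_mem (hh : ∀ s, h s - algebraMap K U (ω s) ∈ I) (s : ℤ) {x : U} (hx : x ∈ I) :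
    h s * x - x * h s ∈ I := by
  have : h s * x - x * h s =
      h s * x - x * (h s - algebraMap K U (ω s)) - algebraMap K U (ω s) * x := by
    rw [Algebra.commutes]
    noncomm_ring
  rw [this]
  exact sub_mem (sub_mem (I.mul_mem_left _ hx) (I.mul_mem_left _ (hh s))) (I.mul_mem_left _ hx)

/-- Polarization of the relations `f_r ^ n ∈ I`. -/
theorem prod_mul_pow_mem [CharZero K] (hh : ∀ s, h s - algebraMap K U (ω s) ∈ I) {n : ℕ}
    (hf : ∀ r, f r ^ n ∈ I) (l : List ℤ) (r : ℤ) (m : ℕ) (hl : l.length + m = n) :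
    (l.map f).prod * f r ^ m ∈ I := by
  induction hk : l.length generalizing l m with
  | zero =>
    obtain rfl := List.length_eq_zero_iff.mp hk
    obtain rfl : m = n := by simpa using hl
    simpa using hf r
  | succ k ih =>
    obtain _ | ⟨a, l⟩ := l
    · simp at hk
    rw [List.length_cons] at hk hl
    have hx := ad_h_mem hh (a - r) (ih l (m + 1) (by omega) (by omega))
    have h1 := H.ad_h_prod_mem (a - r) l
      (I.toAddSubgroup.comap (AddMonoidHom.mulRight (f r ^ (m + 1))))
      fun l' hl' => ih l' (m + 1) (by omega) (by omega)
    have h1' : (h (a - r) * (l.map f).prod - (l.map f).prod * h (a - r)) * f r ^ (m + 1) ∈ I := h1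
    have hc : Commute (f a) (l.map f).prod :=
      Commute.list_prod_right _ _ fun x hx => by
        obtain ⟨b, -, rfl⟩ := List.mem_map.mp hx
        exact H.commute_f a b
    rw [← natCast_mul_mem_iff (K := K) (n := 2 * (m + 1)) (by omega)]
    have key : ((2 * (m + 1) : ℕ) : U) * (((a :: l).map f).prod * f r ^ m) =
        (h (a - r) * (l.map f).prod - (l.map f).prod * h (a - r)) * f r ^ (m + 1)
        - (h (a - r) * ((l.map f).prod * f r ^ (m + 1))
            - (l.map f).prod * f r ^ (m + 1) * h (a - r)) := by
      have e1 : (l.map f).prod * (h (a - r) * f r ^ (m + 1)) =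
          (l.map f).prod * f r ^ (m + 1) * h (a - r)
            - ((2 * (m + 1) : ℕ) : U) * (((a :: l).map f).prod * f r ^ m) := by
        rw [H.h_mul_f_pow, sub_add_cancel, mul_sub, ← mul_assoc, ← mul_assoc _ _ (_ * _),
          ← (Nat.cast_commute _ (l.map f).prod).eq, List.map_cons, List.prod_cons, hc.eq]
        simp only [mul_assoc]
      rw [sub_mul, mul_assoc _ (h (a - r)) (f r ^ _), e1]
      noncomm_ring
    rw [key]
    exact sub_mem h1' hx

theorem prod_mem_of_length_eq [CharZero K] (hh : ∀ s, h s - algebraMap K U (ω s) ∈ I) {n : ℕ}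
    (hf : ∀ r, f r ^ n ∈ I) (l : List ℤ) (hl : l.length = n) : (l.map f).prod ∈ I := by
  simpa using H.prod_mul_pow_mem hh hf l 0 0 (by simpa using hl)

omit H in
theorem commute_map_algebraMap (Λ : K⟦X⟧) (φ : U⟦X⟧) : Commute (map (algebraMap K U) Λ) φ :=
  commute_of_coeff fun _ _ => Algebra.commutes _ _

omit H in
theorem map_euler (Λ : K⟦X⟧) :
    map (algebraMap K U) (euler Λ) = euler (map (algebraMap K U) Λ) := by
  ext n
  simp

theorem coeff_fSeries_pow_mul_mem [CharZero K] (he : ∀ r, e r ∈ I)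
    (hh : ∀ s, h s - algebraMap K U (ω s) ∈ I) {Λ : K⟦X⟧}
    (hΛ : (X * PowerSeries.mk fun n => ω (n + 1 : ℕ)) * Λ = -euler Λ) {n : ℕ} (hf : f 0 ^ n ∈ I)
    (k m : ℕ) (hk : m + k = n) :
    coeff n (fSeries f ^ m * map (algebraMap K U) Λ) ∈ I := by
  induction k generalizing m with
  | zero =>
    obtain rfl : m = n := hk
    have : coeff m (fSeries f ^ m * map (algebraMap K U) Λ) =
        algebraMap K U (constantCoeff Λ) * f 0 ^ m := by
      rw [fSeries, ((commute_X _).symm).mul_pow, mul_assoc, coeff_X_pow_mul']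
      have hΛ0 : constantCoeff (map (algebraMap K U) Λ) = algebraMap K U (constantCoeff Λ) := by
        rw [← coeff_zero_eq_constantCoeff_apply, coeff_map, coeff_zero_eq_constantCoeff_apply]
      simp [hΛ0, Algebra.commutes]
    rw [this]
    exact I.mul_mem_left _ hf
  | succ k ih =>
    set F := fSeries f
    set L := map (algebraMap K U) Λ with hL
    set W := map (algebraMap K U) (X * PowerSeries.mk fun n => ω (n + 1 : ℕ)) with hW
    have hLW : L * W = -euler L := by
      rw [hL, hW, ← map_euler, ← map_neg, ← hΛ, map_mul, mul_comm (_ * _) Λ, ← map_mul, ← map_mul]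
    have h1 : coeff n (PowerSeries.C (e 1) * (F ^ (m + 1) * L)) ∈ I := by
      rw [coeff_C_mul]
      exact I.mul_mem_left _ (ih (m + 1) (by omega))
    have h2 : coeff n (F ^ (m + 1) * L * PowerSeries.C (e 1)) ∈ I := by
      rw [coeff_mul_C]
      exact I.mul_mem_left _ (he 1)
    have h3 : coeff n (((m + 1 : ℕ) : U⟦X⟧) * F ^ m * L * (hSeries h - W)) ∈ I := by
      refine coeff_mul_mem _ (fun i => ?_) n
      rw [map_sub, hW, coeff_map]
      rcases i with _ | i
      · simp
      · rw [coeff_succ_hSeries, coeff_succ_X_mul, coeff_mk]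
        exact hh _
    have key : PowerSeries.C (e 1) * (F ^ (m + 1) * L) = F ^ (m + 1) * L * PowerSeries.C (e 1)
        + ((m + 1 : ℕ) : U⟦X⟧) * F ^ m * L * (hSeries h - W)
        - ((m + 1 : ℕ) : U⟦X⟧) * (euler (F ^ m * L) - (m : U⟦X⟧) * (F ^ m * L)) := by
      rw [← mul_assoc, H.C_mul_fSeries_pow, mul_sub _ (hSeries h) W, mul_assoc _ L W, hLW,
        mul_assoc _ L (PowerSeries.C (e 1)), mul_assoc _ L (hSeries h),
        (commute_map_algebraMap Λ _).eq, (commute_map_algebraMap Λ (hSeries h)).eq, euler_mul]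
      noncomm_ring
    have h4 : coeff n (((m + 1 : ℕ) : U⟦X⟧) * (euler (F ^ m * L) - (m : U⟦X⟧) * (F ^ m * L))) =
        (((m + 1) * (k + 1) : ℕ) : U) * coeff n (F ^ m * L) := by
      rw [← map_natCast (PowerSeries.C (R := U)), ← map_natCast (PowerSeries.C (R := U)) m,
        coeff_C_mul, map_sub, coeff_C_mul, coeff_euler, ← hk]
      push_cast
      noncomm_ring
    rw [← natCast_mul_mem_iff (K := K) (n := (m + 1) * (k + 1)) (by positivity), ← h4]
    rw [key, map_sub, map_add] at h1
    simpa only [sub_sub_cancel] using sub_mem (add_mem h2 h3) h1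

theorem sum_coeff_mul_f_mem [CharZero K] (he : ∀ r, e r ∈ I)
    (hh : ∀ s, h s - algebraMap K U (ω s) ∈ I) {Λ : K⟦X⟧}
    (hΛ : (X * PowerSeries.mk fun n => ω (n + 1 : ℕ)) * Λ = -euler Λ) {n : ℕ}
    (hf : f 0 ^ (n + 1) ∈ I) (s : ℤ) :
    ∑ j ∈ Finset.range (n + 1), coeff j Λ • f (n - j + s) ∈ I := by
  have h0 : ∑ j ∈ Finset.range (n + 1), coeff j Λ • f (n - j) ∈ I := by
    have := H.coeff_fSeries_pow_mul_mem he hh hΛ hf n 1 (add_comm _ _)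
    rw [pow_one, ← (commute_map_algebraMap Λ _).eq, coeff_mul,
      Finset.Nat.sum_antidiagonal_eq_sum_range_succ_mk, Finset.sum_range_succ] at this
    simp only [tsub_self, coeff_zero_eq_constantCoeff_apply, constantCoeff_fSeries, mul_zero,
      add_zero] at this
    convert this using 2 with j hj
    have hj' := Finset.mem_range.mp hj
    rw [show n + 1 - j = (n - j) + 1 by omega, coeff_succ_fSeries, coeff_map, Algebra.smul_def,
      Nat.cast_sub (by omega)]
  have h1 := ad_h_mem hh s h0
  have h2 : h s * (∑ j ∈ Finset.range (n + 1), coeff j Λ • f (n - j))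
      - (∑ j ∈ Finset.range (n + 1), coeff j Λ • f (n - j)) * h s =
      -(((2 : ℕ) : U) * ∑ j ∈ Finset.range (n + 1), coeff j Λ • f (n - j + s)) := by
    rw [Finset.mul_sum, Finset.sum_mul, Finset.mul_sum, ← Finset.sum_sub_distrib,
      ← Finset.sum_neg_distrib]
    refine Finset.sum_congr rfl fun j _ => ?_
    rw [mul_smul_comm, smul_mul_assoc, mul_smul_comm, ← smul_sub, ← smul_neg, H.h_mul_f,
      add_comm s]
    push_cast
    rw [sub_sub_cancel_left]
  rw [h2, neg_mem_iff] at h1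
  exact (natCast_mul_mem_iff (K := K) two_ne_zero).mp h1


omit H in
/-- A two-sided linear recurrence with invertible extreme coefficients confines a sequence to any
submodule containing a window of it. -/
theorem mem_of_recurrence {M : Type*} [AddCommGroup M] [Module K M] (N : Submodule K M)
    (f : ℤ → M) (c : ℕ → K) (n : ℕ) (h0 : c 0 ≠ 0) (hn : c n ≠ 0)
    (hrec : ∀ s : ℤ, ∑ j ∈ Finset.range (n + 1), c j • f (n - j + s) ∈ N)
    (hf : ∀ k : ℕ, k < n → f k ∈ N) (k : ℤ) : f k ∈ N := by
  have window : ∀ m : ℕ, ∀ k : ℤ, -m ≤ k → k < n + m → f k ∈ N := by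
    intro m
    induction m with
    | zero =>
      intro k hk hk'
      lift k to ℕ using by simpa using hk
      exact hf k (by simpa using hk')
    | succ m ih =>
      intro k hk hk'
      push_cast at hk hk'
      by_cases h1 : k = n + m
      · have := hrec m
        rw [Finset.sum_range_succ'] at this
        have h2 : ∑ j ∈ Finset.range n, c (j + 1) • f (n - (j + 1 : ℕ) + m) ∈ N :=
          sum_mem fun j hj => N.smul_mem _ (ih _ (by grind) (by grind))
        have h3 := sub_mem this h2
        rw [add_sub_cancel_left, N.smul_mem_iff h0] at h3
        simpa [h1] using h3
      by_cases h2 : k = -(m + 1)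
      · have := hrec k
        rw [Finset.sum_range_succ] at this
        have h3 : ∑ j ∈ Finset.range n, c j • f (n - j + k) ∈ N :=
          sum_mem fun j hj => N.smul_mem _ (ih _ (by grind) (by grind))
        have h4 := sub_mem this h3
        rw [add_sub_cancel_left, N.smul_mem_iff hn] at h4
        simpa using h4
      exact ih k (by omega) (by omega)
  exact window (k.natAbs + 1) k (by omega) (by omega)

omit H in
theorem coeff_card_prod_one_sub {ι : Type*} [Fintype ι] (a : ι → K) :
    coeff (Fintype.card ι) (∏ j, (1 - PowerSeries.C (a j) * X)) = ∏ j, -a j := by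
  have h1 : ∏ j, (1 - PowerSeries.C (a j) * X) =
      ((∏ j, (1 - Polynomial.C (a j) * Polynomial.X) : Polynomial K) : K⟦X⟧) := by
    rw [← Polynomial.coeToPowerSeries.ringHom_apply, map_prod]
    simp
  have h2 := Polynomial.coeff_prod_of_natDegree_le (s := (Finset.univ : Finset ι))
    (f := fun j => 1 - Polynomial.C (a j) * Polynomial.X) (n := 1) fun j _ => by compute_degree
  rw [h1, Polynomial.coeff_coe, ← Finset.card_univ]
  simpa [Polynomial.coeff_one] using h2

/-- If `I` contains all the `f_n` up to combinations of those with index in `S`, then a monomial in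
the `f_n` is modulo `I` a combination of monomials of the same length with indices in `S`. -/
theorem prod_mem_span_sup {S : Set ℤ}
    (hS : ∀ n, f n ∈ Submodule.span K (f '' S) ⊔ I.restrictScalars K) (l : List ℤ) :
    (l.map f).prod ∈ Submodule.span K
      {u | ∃ l' : List ℤ, l'.length = l.length ∧ (∀ k ∈ l', k ∈ S) ∧ u = (l'.map f).prod}
        ⊔ I.restrictScalars K := by
  induction l with
  | nil => exact Submodule.mem_sup_left (Submodule.subset_span ⟨[], by simp⟩)
  | cons a l ih =>
    set N := Submodule.span K {u | ∃ l' : List ℤ, l'.length = (a :: l).length ∧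
      (∀ k ∈ l', k ∈ S) ∧ u = (l'.map f).prod} ⊔ I.restrictScalars K with hN
    have hI : ∀ x ∈ I, x ∈ N := fun x hx => Submodule.mem_sup_right hx
    suffices h : Submodule.span K {u | ∃ l' : List ℤ, l'.length = l.length ∧ (∀ k ∈ l', k ∈ S) ∧
        u = (l'.map f).prod} ⊔ I.restrictScalars K ≤ N.comap (LinearMap.mulLeft K (f a)) by
      simpa using h ih
    refine sup_le (Submodule.span_le.mpr ?_) fun x hx => hI _ (I.mul_mem_left _ hx)
    rintro _ ⟨l', hl', hlS, rfl⟩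
    have hc : ∀ b, Commute (f b) (l'.map f).prod := fun b =>
      Commute.list_prod_right _ _ fun x hx => by
        obtain ⟨k, -, rfl⟩ := List.mem_map.mp hx
        exact H.commute_f b k
    suffices h' : Submodule.span K (f '' S) ⊔ I.restrictScalars K ≤
        N.comap (LinearMap.mulLeft K (l'.map f).prod) by
      have := h' (hS a)
      rw [Submodule.mem_comap, LinearMap.mulLeft_apply, ← (hc a).eq] at this
      exact this
    refine sup_le (Submodule.span_le.mpr ?_) fun x hx => hI _ (I.mul_mem_left _ hx)
    rintro _ ⟨b, hb, rfl⟩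
    change (l'.map f).prod * f b ∈ N
    rw [← (hc b).eq]
    exact Submodule.mem_sup_left (Submodule.subset_span ⟨b :: l', by simp [hl'],
      by simpa using ⟨hb, hlS⟩, by simp⟩)

/-- The monomials in the `f_n` span the cyclic module `U ⧸ I`. -/
theorem span_prod_sup_eq_top
    (hgen : Algebra.adjoin K (Set.range e ∪ Set.range f ∪ Set.range h) = ⊤)
    (he : ∀ r, e r ∈ I) (hh : ∀ s, h s - algebraMap K U (ω s) ∈ I) :
    Submodule.span K (Set.range fun l : List ℤ => (l.map f).prod) ⊔ I.restrictScalars K = ⊤ := by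
  set M := Submodule.span K (Set.range fun l : List ℤ => (l.map f).prod) ⊔ I.restrictScalars K
  have hl : ∀ l : List ℤ, (l.map f).prod ∈ M := fun l =>
    Submodule.mem_sup_left (Submodule.subset_span ⟨l, rfl⟩)
  have hI : ∀ x ∈ I, x ∈ M := fun x hx => Submodule.mem_sup_right hx
  have h1 : (1 : U) ∈ M := by simpa using hl []
  have stable : ∀ x : U, (∀ l : List ℤ, x * (l.map f).prod ∈ M) → ∀ m ∈ M, x * m ∈ M := by
    intro x hx
    suffices h : M ≤ M.comap (LinearMap.mulLeft K x) from fun m hm => h hm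
    refine sup_le (Submodule.span_le.mpr ?_) fun y hy => hI _ (I.mul_mem_left _ hy)
    rintro _ ⟨l, rfl⟩
    exact hx l
  have hfM : ∀ r, ∀ m ∈ M, f r * m ∈ M := fun r => stable _ fun l => by simpa using hl (r :: l)
  have hhM : ∀ r, ∀ m ∈ M, h r * m ∈ M := fun r => stable _ fun l => by
    induction l with
    | nil =>
      have := add_mem (hI _ (hh r)) (M.smul_mem (ω r) h1)
      simpa [Algebra.algebraMap_eq_smul_one] using this
    | cons a l ih =>
      have h2 := hl ((r + a) :: l)
      have h3 := sub_mem (sub_mem (hfM a _ ih) h2) h2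
      convert h3 using 1
      simp only [List.map_cons, List.prod_cons]
      rw [← mul_assoc, H.h_mul_f]
      noncomm_ring
  have heM : ∀ r, ∀ m ∈ M, e r * m ∈ M := fun r => stable _ fun l => by
    induction l with
    | nil => simpa using hI _ (he r)
    | cons a l ih =>
      have h3 := add_mem (hfM a _ ih) (hhM (r + a) _ (hl l))
      rw [List.map_cons, List.prod_cons, ← mul_assoc, H.e_mul_f, add_mul, mul_assoc]
      exact h3
  rw [Submodule.eq_top_iff']
  intro x
  suffices h : ∀ m ∈ M, x * m ∈ M by simpa using h 1 h1
  have hx : x ∈ Algebra.adjoin K (Set.range e ∪ Set.range f ∪ Set.range h) := hgen ▸ Algebra.mem_top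
  induction hx using Algebra.adjoin_induction with
  | mem x hx =>
    rcases hx with (⟨r, rfl⟩ | ⟨r, rfl⟩) | ⟨r, rfl⟩
    exacts [heM r, hfM r, hhM r]
  | algebraMap r =>
    intro m hm
    rw [← Algebra.smul_def]
    exact M.smul_mem r hm
  | add x y _ _ ihx ihy =>
    intro m hm
    rw [add_mul]
    exact add_mem (ihx m hm) (ihy m hm)
  | mul x y _ _ ihx ihy =>
    intro m hm
    rw [mul_assoc]
    exact ihx _ (ihy m hm)

/-- The module `U ⧸ I` is spanned by the monomials of length at most `n` in `f_0, …, f_(n-1)`. -/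
theorem span_bounded_prod_sup_eq_top [CharZero K] {n : ℕ} (a : Fin n → K) (ha : ∀ j, a j ≠ 0)
    (hgen : Algebra.adjoin K (Set.range e ∪ Set.range f ∪ Set.range h) = ⊤)
    (he : ∀ r, e r ∈ I) (hh : ∀ s : ℤ, h s - algebraMap K U (∑ j, a j ^ s) ∈ I)
    (hf : ∀ r, f r ^ (n + 1) ∈ I) :
    Submodule.span K {u | ∃ l : List ℕ, l.length ≤ n ∧ (∀ k ∈ l, k < n) ∧
      u = (l.map fun k : ℕ => f k).prod} ⊔ I.restrictScalars K = ⊤ := by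
  have hΛ : (X * PowerSeries.mk fun i => ∑ j, a j ^ ((i + 1 : ℕ) : ℤ)) *
      ∏ j, (1 - PowerSeries.C (a j) * X) = -euler (∏ j, (1 - PowerSeries.C (a j) * X)) := by
    rw [← euler_prod_one_sub, ← Finset.mul_sum]
    congr 2
    ext i
    simp only [coeff_mk, map_sum, zpow_natCast]
  have hS : ∀ k, f k ∈ Submodule.span K (f '' ((fun k : ℕ => (k : ℤ)) '' {k | k < n}))
      ⊔ I.restrictScalars K := by
    refine mem_of_recurrence _ f (fun j => coeff j (∏ j, (1 - PowerSeries.C (a j) * X))) n ?_ ?_ ?_ ?_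
    · simp
    · have := coeff_card_prod_one_sub a
      rw [Fintype.card_fin] at this
      simp only [this]
      exact Finset.prod_ne_zero_iff.mpr fun j _ => neg_ne_zero.mpr (ha j)
    · exact fun s => Submodule.mem_sup_right (H.sum_coeff_mul_f_mem he hh hΛ (hf 0) s)
    · exact fun k hk => Submodule.mem_sup_left (Submodule.subset_span ⟨k, ⟨k, hk, rfl⟩, rfl⟩)
  rw [eq_top_iff, ← H.span_prod_sup_eq_top hgen he hh]
  refine sup_le (Submodule.span_le.mpr ?_) le_sup_right
  rintro _ ⟨l, rfl⟩
  by_cases hln : l.length ≤ n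
  · refine SetLike.le_def.mp (sup_le_sup_right (Submodule.span_mono ?_) _) (H.prod_mem_span_sup hS l)
    rintro _ ⟨l', hl', hlS, rfl⟩
    have : ∀ k ∈ l', ((k.toNat : ℕ) : ℤ) = k ∧ k.toNat < n := fun k hk => by
      obtain ⟨i, hi, rfl⟩ := hlS k hk
      simpa using hi
    refine ⟨l'.map Int.toNat, by simpa [hl'] using hln, ?_, ?_⟩
    · simpa using fun k hk => (this k hk).2
    · rw [List.map_map]
      congr 1
      refine List.map_congr_left fun k hk => ?_
      rw [Function.comp_apply, (this k hk).1]
  · refine Submodule.mem_sup_right ?_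
    change (l.map f).prod ∈ I
    rw [← List.take_append_drop (l.length - (n + 1)) l, List.map_append, List.prod_append]
    refine I.mul_mem_left _ (H.prod_mem_of_length_eq hh hf _ ?_)
    rw [List.length_drop]
    omega

end IsLoopTriple

theorem sl2_eq_smul_add (x : sl (Fin 2) ℂ) :
    x = x.val 0 1 • Esl2 + x.val 1 0 • Fsl2 + x.val 0 0 • Hsl2 := by
  have hx : x.val 0 0 + x.val 1 1 = 0 := by
    rw [← Matrix.trace_fin_two]
    exact x.2
  apply Subtype.ext
  ext i j
  fin_cases i <;> fin_cases j <;> simp [Esl2, Fsl2, Hsl2]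
  linear_combination hx

theorem lie_Esl2_Fsl2 : ⁅Esl2, Fsl2⁆ = Hsl2 := by
  apply Subtype.ext
  ext i j
  fin_cases i <;> fin_cases j <;> simp [Esl2, Fsl2, Hsl2, Ring.lie_def]

theorem lie_Hsl2_Fsl2 : ⁅Hsl2, Fsl2⁆ = -(Fsl2 + Fsl2) := by
  apply Subtype.ext
  ext i j
  fin_cases i <;> fin_cases j <;> simp [Fsl2, Hsl2, Ring.lie_def]
  norm_num

theorem UniversalEnvelopingAlgebra.ι_mul_ι {R L : Type*} [CommRing R] [LieRing L]
    [LieAlgebra R L] (x y : L) : ι R x * ι R y = ι R y * ι R x + ι R ⁅x, y⁆ := by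
  have h : ι R ⁅x, y⁆ = ι R x * ι R y - ι R y * ι R x :=
    @LieHom.map_lie _ _ _ _ _ _ LieRing.ofAssociativeRing _ (ι R) x y
  rw [h, add_sub_cancel]

theorem isLoopTriple : IsLoopTriple Eel Fel Hel where
  e_mul_f r s := by
    simp only [Eel, Fel, Hel]
    rw [UniversalEnvelopingAlgebra.ι_mul_ι, LieAlgebra.ExtendScalars.bracket_tmul, lie_Esl2_Fsl2,
      ← T_add]
  h_mul_f r s := by
    simp only [Fel, Hel]
    rw [UniversalEnvelopingAlgebra.ι_mul_ι, LieAlgebra.ExtendScalars.bracket_tmul, lie_Hsl2_Fsl2,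
      ← T_add, TensorProduct.tmul_neg, TensorProduct.tmul_add, map_neg, map_add, two_mul, sub_eq_add_neg]
  commute_f r s := by
    change Fel r * Fel s = Fel s * Fel r
    simp only [Fel]
    rw [UniversalEnvelopingAlgebra.ι_mul_ι, LieAlgebra.ExtendScalars.bracket_tmul, lie_self,
      TensorProduct.tmul_zero, map_zero,
      add_zero]

theorem UniversalEnvelopingAlgebra.adjoin_range_ι {R L : Type*} [CommRing R] [LieRing L]
    [LieAlgebra R L] :
    Algebra.adjoin R (Set.range (ι R (L := L))) = ⊤ := by
  have h : Set.range (ι R (L := L)) = mkAlgHom R L '' Set.range (TensorAlgebra.ι R) := by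
    rw [← Set.range_comp]
    rfl
  rw [h, ← AlgHom.map_adjoin, TensorAlgebra.adjoin_range_ι, Algebra.map_top,
    AlgHom.range_eq_top]
  exact RingCon.mkₐ_surjective _

theorem adjoin_Eel_Fel_Hel :
    Algebra.adjoin ℂ (Set.range Eel ∪ Set.range Fel ∪ Set.range Hel) = (⊤ : Subalgebra ℂ Ug) := by
  set S := Algebra.adjoin ℂ (Set.range Eel ∪ Set.range Fel ∪ Set.range Hel)
  rw [eq_top_iff, ← UniversalEnvelopingAlgebra.adjoin_range_ι, Algebra.adjoin_le_iff]
  rintro _ ⟨z, rfl⟩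
  have key : ∀ x : sl (Fin 2) ℂ,
      (∀ r : ℤ, UniversalEnvelopingAlgebra.ι ℂ ((T r : ℂ[T;T⁻¹]) ⊗ₜ[ℂ] x) ∈ S) →
      ∀ p : ℂ[T;T⁻¹], UniversalEnvelopingAlgebra.ι ℂ (p ⊗ₜ[ℂ] x) ∈ S := by
    intro x hx p
    induction p using LaurentPolynomial.induction_on' with
    | add p q hp hq =>
      rw [TensorProduct.add_tmul, map_add]
      exact add_mem hp hq
    | C_mul_T n c =>
      rw [← smul_eq_C_mul, ← TensorProduct.smul_tmul', map_smul]
      exact S.smul_mem (hx n) c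
  induction z using TensorProduct.induction_on with
  | zero => rw [map_zero]; exact zero_mem S
  | add x y hx hy => rw [map_add]; exact add_mem hx hy
  | tmul p x =>
    have hE := key Esl2 (fun r => Algebra.subset_adjoin (Or.inl (Or.inl ⟨r, rfl⟩))) p
    have hF := key Fsl2 (fun r => Algebra.subset_adjoin (Or.inl (Or.inr ⟨r, rfl⟩))) p
    have hH := key Hsl2 (fun r => Algebra.subset_adjoin (Or.inr ⟨r, rfl⟩)) p
    rw [sl2_eq_smul_add x]
    simp only [TensorProduct.tmul_add, TensorProduct.tmul_smul, map_add, map_smul]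
    exact add_mem (add_mem (S.smul_mem hE _) (S.smul_mem hF _)) (S.smul_mem hH _)

/-- The Weyl module `W(ω) = U(g̃)/I` is spanned over `ℂ` by the image of `1`
together with the images of the monomials `f_{s_1}⋯f_{s_N}` with `1 ≤ N ≤ λ`
and `0 ≤ s_j ≤ λ − 1`. -/
theorem weyl_module_spanned_by_monomials (lam : ℕ) (a : Fin lam → ℂ)
    (ha : ∀ j, a j ≠ 0) :
    Submodule.span ℂ
      ((Submodule.Quotient.mk (p := (weylIdeal lam a : Submodule Ug Ug))) ''
        {u : Ug | u = 1 ∨ ∃ N : ℕ, (1 ≤ N ∧ N ≤ lam) ∧ ∃ s : Fin N → ℕ,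
          (∀ j, s j < lam) ∧ u = (List.ofFn fun j => Fel (s j : ℤ)).prod}) = ⊤ := by
  have htop := isLoopTriple.span_bounded_prod_sup_eq_top (I := weylIdeal lam a) a ha
    adjoin_Eel_Fel_Hel (fun r => Ideal.subset_span (Or.inl (Or.inl ⟨r, rfl⟩)))
    (fun s => Ideal.subset_span (Or.inl (Or.inr ⟨s, rfl⟩)))
    (fun r => Ideal.subset_span (Or.inr ⟨r, rfl⟩))
  rw [eq_top_iff]
  rintro y -
  obtain ⟨x, rfl⟩ := Submodule.Quotient.mk_surjective _ y
  have hx := htop ▸ Submodule.mem_top (x := x)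
  obtain ⟨u, hu, i, hi, rfl⟩ := Submodule.mem_sup.mp hx
  have hi' : Submodule.Quotient.mk (p := (weylIdeal lam a : Submodule Ug Ug)) i = 0 :=
    (Submodule.Quotient.mk_eq_zero _).mpr hi
  rw [Submodule.Quotient.mk_add, hi', add_zero]
  have hmap := Submodule.mem_map_of_mem
    (f := (Submodule.mkQ (weylIdeal lam a : Submodule Ug Ug)).restrictScalars ℂ) hu
  rw [Submodule.map_span] at hmap
  refine Submodule.span_mono (Set.image_mono ?_) hmap
  rintro _ ⟨l, hl, hlt, rfl⟩
  rcases l with _ | ⟨k, l⟩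
  · exact Or.inl (by simp)
  · refine Or.inr ⟨_, ⟨by simp, hl⟩, (k :: l).get, fun j => hlt _ (List.get_mem _ _), ?_⟩
    congr 1
    rw [List.ofFn_comp' (k :: l).get fun k : ℕ => Fel k, List.ofFn_get]
end

section
/- Let g = sl₂(ℂ) with standard basis e, f, h, let g̃ = ℂ[t,t⁻¹] ⊗ g be its loop algebra, and write x_r for the action of t^r ⊗ x on a g̃-module. Let V be a nonzero finite-dimensional irreducible g̃-module. Then V contains a nonzero vector v which is a common eigenvector of the operators h_s for all s ∈ ℤ and which satisfies e_r·v = 0 for all r ∈ ℤ; that is, every finite-dimensional irreducible g̃-module is an ℓ-highest-weight module. -/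
set_option synthInstance.maxHeartbeats 1000000
set_option maxHeartbeats 1000000

open scoped TensorProduct
open LaurentPolynomial LieAlgebra.SpecialLinear

/-- A commuting family of endomorphisms preserving a nonzero finite-dimensional subspace has a
common eigenvector in that subspace. -/
theorem Module.End.exists_common_eigenvector_of_commute {K V ι : Type*} [Field K] [IsAlgClosed K]
    [AddCommGroup V] [Module K V] [FiniteDimensional K V] (f : ι → Module.End K V)
    (hf : ∀ i j, Commute (f i) (f j)) (W : Submodule K V) (hW : W ≠ ⊥)
    (hfW : ∀ i, ∀ v ∈ W, f i v ∈ W) :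
    ∃ v ∈ W, v ≠ 0 ∧ ∀ i, ∃ c : K, f i v = c • v := by
  obtain ⟨U, ⟨hUW, hU, hfU⟩, hmin⟩ := exists_minimal_of_wellFoundedLT
    (fun U : Submodule K V ↦ U ≤ W ∧ U ≠ ⊥ ∧ ∀ i, ∀ v ∈ U, f i v ∈ U) ⟨W, le_rfl, hW, hfW⟩
  obtain ⟨v, hvU, hv⟩ := U.exists_mem_ne_zero_of_ne_bot hU
  refine ⟨v, hUW hvU, hv, fun i ↦ ?_⟩
  have : Nontrivial U := U.nontrivial_iff_ne_bot.mpr hU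
  obtain ⟨c, hc⟩ := Module.End.exists_eigenvalue ((f i).restrict (hfU i))
  obtain ⟨⟨u, huU⟩, hu⟩ := hc.exists_hasEigenvector
  have hu' : f i u = c • u := congrArg Subtype.val hu.apply_eq_smul
  have hle : U ≤ U ⊓ (f i).eigenspace c := by
    refine hmin ⟨inf_le_left.trans hUW, ?_, fun j w hw ↦ ⟨hfU j w hw.1, ?_⟩⟩ inf_le_left
    · refine Submodule.ne_bot_iff _ |>.mpr
        ⟨u, ⟨huU, Module.End.mem_eigenspace_iff.mpr hu'⟩, fun h ↦ hu.2 ?_⟩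
      exact Subtype.ext h
    · have hw' := Module.End.mem_eigenspace_iff.mp hw.2
      refine Module.End.mem_eigenspace_iff.mpr ?_
      have := LinearMap.congr_fun (hf i j) w
      simp only [Module.End.mul_apply] at this
      rw [this, hw', map_smul]
  exact ⟨c, Module.End.mem_eigenspace_iff.mp (hle hvU).2⟩

/-- In characteristic zero, an eigenvalue can be chosen so that shifting it by a given nonzero
scalar no longer gives an eigenvalue. -/
theorem Module.End.exists_hasEigenvalue_not_hasEigenvalue_add {K V : Type*} [Field K]
    [IsAlgClosed K] [CharZero K] [AddCommGroup V] [Module K V] [FiniteDimensional K V]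
    [Nontrivial V] (f : Module.End K V) {a : K} (ha : a ≠ 0) :
    ∃ c, f.HasEigenvalue c ∧ ¬ f.HasEigenvalue (c + a) := by
  by_contra! h
  obtain ⟨c, hc⟩ := Module.End.exists_eigenvalue f
  have hn (n : ℕ) : f.HasEigenvalue (c + n * a) := by
    induction n with
    | zero => simpa using hc
    | succ n ih =>
      have := h _ ih
      rwa [add_assoc, ← add_one_mul, ← Nat.cast_add_one] at this
  refine Set.infinite_of_injective_forall_mem (f := fun n : ℕ ↦ c + n * a) (fun m n hmn ↦ ?_) hn
    (Module.End.finite_hasEigenvalue f)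
  simpa [ha] using hmn

theorem lie_Hsl2_Esl2 : ⁅Hsl2, Esl2⁆ = (2 : ℂ) • Esl2 := by
  apply Subtype.ext
  change ⁅!![(1 : ℂ), 0; 0, -1], !![(0 : ℂ), 1; 0, 0]⁆ = (2 : ℂ) • !![(0 : ℂ), 1; 0, 0]
  rw [Ring.lie_def]
  ext i j
  fin_cases i <;> fin_cases j <;> norm_num [Matrix.mul_apply, Fin.sum_univ_two]

/-- Every nonzero finite-dimensional irreducible `g̃`-module contains a nonzero
vector `v` which is a common eigenvector of all `h_s` and is annihilated by all
`e_r`; i.e. it is an `ℓ`-highest-weight module. -/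
theorem loop_sl2_irreducible_has_highestWeight_vector
    (V : Type*) [AddCommGroup V] [Module ℂ V]
    [LieRingModule loopSl2 V] [LieModule ℂ loopSl2 V] [FiniteDimensional ℂ V]
    [LieModule.IsIrreducible ℂ loopSl2 V] :
    ∃ v : V, v ≠ 0 ∧
      (∀ s : ℤ, ∃ c : ℂ, ⁅(T s : ℂ[T;T⁻¹]) ⊗ₜ[ℂ] Hsl2, v⁆ = c • v) ∧
      ∀ r : ℤ, ⁅(T r : ℂ[T;T⁻¹]) ⊗ₜ[ℂ] Esl2, v⁆ = 0 := by
  have : Nontrivial V := by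
    by_contra hV
    rw [not_nontrivial_iff_subsingleton] at hV
    exact bot_ne_top (α := LieSubmodule ℂ loopSl2 V) (Subsingleton.elim _ _)
  let H (s : ℤ) : Module.End ℂ V :=
    LieModule.toEnd ℂ loopSl2 V ((T s : ℂ[T;T⁻¹]) ⊗ₜ[ℂ] Hsl2)
  have hH (s t : ℤ) : Commute (H s) (H t) := by
    refine LinearMap.ext fun w ↦ ?_
    change ⁅(T s : ℂ[T;T⁻¹]) ⊗ₜ[ℂ] Hsl2, ⁅(T t : ℂ[T;T⁻¹]) ⊗ₜ[ℂ] Hsl2, w⁆⁆ = _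
    rw [leibniz_lie, LieAlgebra.ExtendScalars.bracket_tmul, lie_self, TensorProduct.tmul_zero,
      zero_lie, zero_add]
    rfl
  obtain ⟨c, hc, hc'⟩ :=
    (H 0).exists_hasEigenvalue_not_hasEigenvalue_add (two_ne_zero (α := ℂ))
  obtain ⟨v, hvW, hv, hvH⟩ := Module.End.exists_common_eigenvector_of_commute H hH
    ((H 0).eigenspace c) hc fun s w hw ↦ by
      rw [Module.End.mem_eigenspace_iff] at hw ⊢
      have := LinearMap.congr_fun (hH 0 s) w
      simp only [Module.End.mul_apply] at this
      rw [this, hw, map_smul]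
  refine ⟨v, hv, hvH, fun r ↦ ?_⟩
  by_contra hr
  refine hc' (Module.End.hasEigenvalue_of_hasEigenvector
    (x := ⁅(T r : ℂ[T;T⁻¹]) ⊗ₜ[ℂ] Esl2, v⁆) ⟨Module.End.mem_eigenspace_iff.mpr ?_, hr⟩)
  have hv0 : ⁅(T 0 : ℂ[T;T⁻¹]) ⊗ₜ[ℂ] Hsl2, v⁆ = c • v := Module.End.mem_eigenspace_iff.mp hvW
  have h2 : ⁅(2 : ℂ) • (T r : ℂ[T;T⁻¹]) ⊗ₜ[ℂ] Esl2, v⁆ =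
      (2 : ℂ) • ⁅(T r : ℂ[T;T⁻¹]) ⊗ₜ[ℂ] Esl2, v⁆ := smul_lie _ _ _
  change ⁅(T 0 : ℂ[T;T⁻¹]) ⊗ₜ[ℂ] Hsl2, _⁆ = _
  rw [leibniz_lie, hv0, LieAlgebra.ExtendScalars.bracket_tmul, ← T_add, zero_add, lie_Hsl2_Esl2,
    TensorProduct.tmul_smul, h2, lie_smul, ← add_smul, add_comm]
end
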